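/- For every 4-edge-connected multigraph G and every vertex r of G, there exists a set of four edge-independent spanning trees of G rooted at r. -/

import Mathlib

set_option autoImplicit false

/-- A multigraph: a type of vertices, a type of edges, and a map assigning to each
edge its unordered pair of endpoints (a loop has endpoints `s(v, v)`). -/
structure MG : Type 1 where
  V : Type
  E : Type
  ends : E → Sym2 V

namespace MG

variable (G : MG)

/-- The set of vertices covered by a set `F` of edges. -/
def vertsOf (F : Set G.E) : Set G.V := {v | ∃ e ∈ F, v ∈ G.ends e}

/-- The degree of a vertex `v` with respect to a set `F` of edges;
a loop contributes two to the degree. -/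
noncomputable def deg (F : Set G.E) (v : G.V) : ℕ :=
  {e ∈ F | v ∈ G.ends e}.ncard + {e ∈ F | G.ends e = s(v, v)}.ncard

/-- `G` has no isolated vertices. -/
def NoIsolated : Prop := ∀ v : G.V, ∃ e : G.E, v ∈ G.ends e

/-- `IsLink vs es`: the edge list `es` successively links the consecutive
vertices of the vertex list `vs`. -/
def IsLink : List G.V → List G.E → Prop
  | [_], [] => True
  | a :: b :: vs, e :: es => G.ends e = s(a, b) ∧ IsLink (b :: vs) es
  | _, _ => False

/-- `vs, es` form a (simple) path: distinct vertices, distinct edges, consecutive linking. -/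
def IsPath (vs : List G.V) (es : List G.E) : Prop :=
  vs.Nodup ∧ es.Nodup ∧ G.IsLink vs es

/-- `v :: vs, es` form a (simple) cycle through the basepoint `v`:
the distinct vertices `v :: vs` are linked cyclically by the distinct edges `es`.
A loop gives a cycle of length one and two parallel edges give a cycle of length two. -/
def IsCycle (v : G.V) (vs : List G.V) (es : List G.E) : Prop :=
  (v :: vs).Nodup ∧ es.Nodup ∧ es ≠ [] ∧ G.IsLink (v :: (vs ++ [v])) es

/-- Reachability using only edges from `F`. -/
def Reach (F : Set G.E) : G.V → G.V → Prop :=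
  Relation.ReflTransGen (fun a b => ∃ e ∈ F, G.ends e = s(a, b))

/-- `G` with edge set restricted to `F` is connected as a graph on all of `G.V`. -/
def ConnectedOn (F : Set G.E) : Prop := ∀ a b : G.V, G.Reach F a b

/-- The subgraph formed by the edge set `F` together with the vertices it covers
is connected. -/
def ConnectedWithin (F : Set G.E) : Prop :=
  ∀ a ∈ G.vertsOf F, ∀ b ∈ G.vertsOf F, G.Reach F a b

/-- `G` is 4-edge-connected: at least two vertices, and deleting any set of fewer
than four edges leaves the graph connected. -/
def FourEdgeConnected : Prop :=
  2 ≤ Nat.card G.V ∧ ∀ S : Set G.E, S.Finite → S.ncard < 4 → G.ConnectedOn Sᶜ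

/-- `e` is a cut edge of the subgraph formed by the edge set `F`: removing `e`
disconnects two vertices of that subgraph. -/
def IsCutEdge (F : Set G.E) (e : G.E) : Prop :=
  e ∈ F ∧ ∃ a ∈ G.vertsOf F, ∃ b ∈ G.vertsOf F, ¬ G.Reach (F \ {e}) a b

/-! ### Chains -/

/-- An open up chain with respect to `(H, Hb)`, rooted at `r`: a path with at least
one edge, edge-disjoint from `H` and `Hb`, in which every vertex is `r` or has degree
at least two in `Hb`, and whose ends are `r` or lie in `H`. -/
def IsOpenUpChain (r : G.V) (H Hb C : Set G.E) : Prop :=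
  Disjoint C H ∧ Disjoint C Hb ∧
  ∃ vs es, G.IsPath vs es ∧ es ≠ [] ∧ C = {e | e ∈ es} ∧
    (∀ v ∈ vs, v = r ∨ 2 ≤ G.deg Hb v) ∧
    (∀ v, vs.head? = some v → v = r ∨ v ∈ G.vertsOf H) ∧
    (∀ v, vs.getLast? = some v → v = r ∨ v ∈ G.vertsOf H)

/-- A closed up chain with respect to `(H, Hb)`, rooted at `r`, with common end `v`:
a cycle through `v`, edge-disjoint from `H` and `Hb`, in which every vertex is `r` or
has degree at least two in `Hb`, and the end `v` is `r` or has degree at least two in `H`. -/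
def IsClosedUpChain (r : G.V) (H Hb C : Set G.E) (v : G.V) : Prop :=
  Disjoint C H ∧ Disjoint C Hb ∧
  ∃ vs es, G.IsCycle v vs es ∧ C = {e | e ∈ es} ∧
    (∀ u ∈ v :: vs, u = r ∨ 2 ≤ G.deg Hb u) ∧
    (v = r ∨ 2 ≤ G.deg H v)

/-- An up chain with respect to `(H, Hb)`. -/
def IsUpChain (r : G.V) (H Hb C : Set G.E) : Prop :=
  G.IsOpenUpChain r H Hb C ∨ ∃ v, G.IsClosedUpChain r H Hb C v

/-- A down chain with respect to `(H, Hb)` is an up chain with respect to `(Hb, H)`. -/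
def IsDownChain (r : G.V) (H Hb C : Set G.E) : Prop := G.IsUpChain r Hb H C

/-- A closed down chain with respect to `(H, Hb)` with common end `v`. -/
def IsClosedDownChain (r : G.V) (H Hb C : Set G.E) (v : G.V) : Prop :=
  G.IsClosedUpChain r Hb H C v

/-- A one-way chain with respect to `(H, Hb)`, with tail `u` and head `v`:
a single edge `e ∉ H ∪ Hb` with ends `u` and `v`, where the tail `u` is `r` or has
degree at least two in `H`, and the head `v` is `r` or has degree at least two in `Hb`. -/
def IsOneWayChainAt (r : G.V) (H Hb C : Set G.E) (u v : G.V) : Prop :=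
  ∃ e, e ∉ H ∧ e ∉ Hb ∧ C = {e} ∧ G.ends e = s(u, v) ∧
    (u = r ∨ 2 ≤ G.deg H u) ∧ (v = r ∨ 2 ≤ G.deg Hb v)

/-- A one-way chain with respect to `(H, Hb)`. -/
def IsOneWayChain (r : G.V) (H Hb C : Set G.E) : Prop :=
  ∃ u v, G.IsOneWayChainAt r H Hb C u v

/-- A chain with respect to `(H, Hb)`: an up chain, a down chain, or a one-way chain. -/
def IsChain (r : G.V) (H Hb C : Set G.E) : Prop :=
  G.IsUpChain r H Hb C ∨ G.IsDownChain r H Hb C ∨ G.IsOneWayChain r H Hb C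

/-- `H_i`: the union of the chains with index `< i`. -/
def before {n : ℕ} (Gs : Fin n → Set G.E) (i : Fin n) : Set G.E :=
  {e | ∃ j, j < i ∧ e ∈ Gs j}

/-- `Hbar_i`: the union of the chains with index `> i`. -/
def after {n : ℕ} (Gs : Fin n → Set G.E) (i : Fin n) : Set G.E :=
  {e | ∃ j, i < j ∧ e ∈ Gs j}

/-- `Gs` is a chain decomposition, rooted at `r`, of the part of `G` with edge set `F`:
the `Gs i` partition `F`, and each `Gs i` is an up chain, a down chain or a one-way
chain with respect to `(H_i, Hbar_i)`. -/
def IsChainDecompOn (F : Set G.E) (r : G.V) {n : ℕ} (Gs : Fin n → Set G.E) : Prop :=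
  (∀ i j, i ≠ j → Disjoint (Gs i) (Gs j)) ∧ (⋃ i, Gs i) = F ∧
  ∀ i, G.IsChain r (G.before Gs i) (G.after Gs i) (Gs i)

/-- `Gs` is a chain decomposition of `G` rooted at `r`. -/
def IsChainDecomp (r : G.V) {n : ℕ} (Gs : Fin n → Set G.E) : Prop :=
  G.IsChainDecompOn Set.univ r Gs

/-- `G` has a chain decomposition rooted at `r`. -/
def HasChainDecomp (r : G.V) : Prop :=
  ∃ (m : ℕ) (Gs : Fin (m + 1) → Set G.E), G.IsChainDecomp r Gs

/-- A minimal open up chain: an open up chain none of whose internal vertices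
lies in `{r} ∪ V(H)`. -/
def IsMinimalOpenUpChain (r : G.V) (H Hb C : Set G.E) : Prop :=
  Disjoint C H ∧ Disjoint C Hb ∧
  ∃ vs es, G.IsPath vs es ∧ es ≠ [] ∧ C = {e | e ∈ es} ∧
    (∀ v ∈ vs, v = r ∨ 2 ≤ G.deg Hb v) ∧
    (∀ v, vs.head? = some v → v = r ∨ v ∈ G.vertsOf H) ∧
    (∀ v, vs.getLast? = some v → v = r ∨ v ∈ G.vertsOf H) ∧
    (∀ v ∈ vs, vs.head? ≠ some v → vs.getLast? ≠ some v → v ≠ r ∧ v ∉ G.vertsOf H)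

/-- A minimal up chain: an up chain none of whose internal vertices lies in
`{r} ∪ V(H)`. -/
def IsMinimalUpChain (r : G.V) (H Hb C : Set G.E) : Prop :=
  G.IsMinimalOpenUpChain r H Hb C ∨
  ∃ v, G.IsClosedUpChain r H Hb C v ∧
    ∀ u ∈ G.vertsOf C, u ≠ v → u ≠ r ∧ u ∉ G.vertsOf H

/-- A minimal down chain: a down chain none of whose internal vertices lies in
`{r} ∪ V(Hb)`. -/
def IsMinimalDownChain (r : G.V) (H Hb C : Set G.E) : Prop :=
  G.IsMinimalUpChain r Hb H C

/-- A minimal chain decomposition (of the part of `G` with edge set `F`):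
a chain decomposition all of whose up chains and down chains are minimal. -/
def IsMinimalChainDecompOn (F : Set G.E) (r : G.V) {n : ℕ} (Gs : Fin n → Set G.E) : Prop :=
  G.IsChainDecompOn F r Gs ∧
  ∀ i, G.IsMinimalUpChain r (G.before Gs i) (G.after Gs i) (Gs i) ∨
       G.IsMinimalDownChain r (G.before Gs i) (G.after Gs i) (Gs i) ∨
       G.IsOneWayChain r (G.before Gs i) (G.after Gs i) (Gs i)

/-- A minimal chain decomposition of `G` rooted at `r`. -/
def IsMinimalChainDecomp (r : G.V) {n : ℕ} (Gs : Fin n → Set G.E) : Prop :=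
  G.IsMinimalChainDecompOn Set.univ r Gs

/-! ### Subgraphs, trees and edge-independence -/

/-- A subgraph of `G`: a set of vertices together with a set of edges all of whose
endpoints lie in the vertex set. -/
structure Sub (G : MG) where
  verts : Set G.V
  edges : Set G.E
  valid : ∀ e ∈ edges, ∀ v ∈ G.ends e, v ∈ verts

/-- A subgraph is connected. -/
def Sub.Connected {G : MG} (T : Sub G) : Prop :=
  T.verts.Nonempty ∧ ∀ a ∈ T.verts, ∀ b ∈ T.verts,
    Relation.ReflTransGen (fun x y => ∃ e ∈ T.edges, G.ends e = s(x, y)) a b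

/-- A subgraph is a tree: connected and containing no cycle. -/
def Sub.IsTree {G : MG} (T : Sub G) : Prop :=
  T.Connected ∧ ¬ ∃ v vs es, G.IsCycle v vs es ∧ ∀ e ∈ es, e ∈ T.edges

/-- A subgraph is spanning. -/
def Sub.Spanning {G : MG} (T : Sub G) : Prop := T.verts = Set.univ

/-- `vs, es` is a path from `a` to `b` all of whose edges lie in the subgraph `T`. -/
def Sub.PathIn {G : MG} (T : Sub G) (a b : G.V) (vs : List G.V) (es : List G.E) : Prop :=
  G.IsPath vs es ∧ vs.head? = some a ∧ vs.getLast? = some b ∧ ∀ e ∈ es, e ∈ T.edges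

/-- Two subtrees of `G` are edge-independent with root `r`: each contains `r`, and for
every common vertex `v`, the path between `r` and `v` in one tree is edge-disjoint from
the path between `r` and `v` in the other. -/
def EdgeIndependent (r : G.V) (T₁ T₂ : Sub G) : Prop :=
  r ∈ T₁.verts ∧ r ∈ T₂.verts ∧
  ∀ v ∈ T₁.verts ∩ T₂.verts, ∀ vs₁ es₁ vs₂ es₂,
    T₁.PathIn r v vs₁ es₁ → T₂.PathIn r v vs₂ es₂ → ∀ e ∈ es₁, e ∉ es₂

/-- `G` has a set of four edge-independent spanning trees rooted at `r`. -/
def HasFourEIST (r : G.V) : Prop :=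
  ∃ T : Fin 4 → Sub G, (∀ i, (T i).IsTree ∧ (T i).Spanning) ∧
    ∀ i j, i ≠ j → G.EdgeIndependent r (T i) (T j)

/-! ### Mader operations -/

/-- Add to `G` a new edge with the (not necessarily distinct) endpoints `p`. -/
def addEdge (p : Sym2 G.V) : MG :=
  ⟨G.V, Option G.E, fun e => e.elim p G.ends⟩

/-- Pinch the two distinct edges `e₁` (with ends `x`, `y`) and `e₂` (with ends `z`, `w`):
delete `e₁` and `e₂`, add a new vertex (`none`), and add four new edges joining the new
vertex to `x`, `y`, `z`, `w` respectively. -/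
def pinch (e₁ e₂ : G.E) (x y z w : G.V) : MG where
  V := Option G.V
  E := {e : G.E // e ≠ e₁ ∧ e ≠ e₂} ⊕ Fin 4
  ends := fun e =>
    Sum.elim (fun e' => (G.ends e'.1).map some)
      (fun i =>
        if i = 0 then s((none : Option G.V), some x)
        else if i = 1 then s((none : Option G.V), some y)
        else if i = 2 then s((none : Option G.V), some z)
        else s((none : Option G.V), some w)) e

end MG

/-- A multigraph with a distinguished root vertex. -/
structure PMG : Type 1 where
  G : MG
  r : G.V

/-- A single Mader operation on a rooted multigraph: either add an edge, or pinch two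
distinct edges. -/
inductive MaderStep : PMG → PMG → Prop
  | addEdge (P : PMG) (p : Sym2 P.G.V) : MaderStep P ⟨P.G.addEdge p, P.r⟩
  | pinch (P : PMG) (e₁ e₂ : P.G.E) (x y z w : P.G.V) (hne : e₁ ≠ e₂)
      (h₁ : P.G.ends e₁ = s(x, y)) (h₂ : P.G.ends e₂ = s(z, w)) :
      MaderStep P ⟨P.G.pinch e₁ e₂ x y z w, some P.r⟩

/-- The starting graph `G⁰` of the Mader construction: two vertices joined by four
parallel edges, rooted at one of them. -/
def basePMG : PMG :=
  ⟨⟨Bool, Fin 4, fun _ => s(false, true)⟩, false⟩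

/-- An isomorphism of rooted multigraphs: bijections on vertices and edges commuting
with the endpoint maps and sending root to root. -/
def PIso (P Q : PMG) : Prop :=
  ∃ (fV : P.G.V ≃ Q.G.V) (fE : P.G.E ≃ Q.G.E),
    (∀ e, Q.G.ends (fE e) = (P.G.ends e).map fV) ∧ fV P.r = Q.r

/-- `G`, rooted at `r`, can be built from `basePMG` by repeatedly performing
Mader operations. -/
def MaderConstructible (G : MG) (r : G.V) : Prop :=
  ∃ Q : PMG, Relation.ReflTransGen MaderStep basePMG Q ∧ PIso Q ⟨G, r⟩

namespace EdgeOrder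

variable {V E : Type} [DecidableEq V]

/-- `1` if the pair `a, b` is separated by `X`, and `0` otherwise. -/
def cross (a b : V) (X : Finset V) : ℕ := if (a ∈ X ↔ b ∈ X) then 0 else 1

/-- The number of edges of `F`, where `e` joins `p e` and `q e`, in the boundary of `X`. -/
def cut (p q : E → V) (F : Finset E) (X : Finset V) : ℕ := ∑ e ∈ F, cross (p e) (q e) X

/-- The number of edges of `F` in the boundary of `X` with time at most `m`. -/
def early (p q : E → V) (F : Finset E) (τ : E → ℤ) (m : ℤ) (X : Finset V) : ℕ :=
  ∑ e ∈ F, if τ e ≤ m then cross (p e) (q e) X else 0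

/-- The number of edges of `F` in the boundary of `X` with time greater than `m`. -/
def late (p q : E → V) (F : Finset E) (τ : E → ℤ) (m : ℤ) (X : Finset V) : ℕ :=
  ∑ e ∈ F, if m < τ e then cross (p e) (q e) X else 0

/-- A set function that is submodular for crossing and for intersecting pairs, and vanishes
at the empty set, like the cut function of a graph. -/
structure IsCutLike (d : Finset V → ℕ) : Prop where
  empty : d ∅ = 0
  inter_union : ∀ X Y, d (X ∩ Y) + d (X ∪ Y) ≤ d X + d Y
  sdiff_sdiff : ∀ X Y, d (X \ Y) + d (Y \ X) ≤ d X + d Y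

theorem isCutLike_sum (p q : E → V) (F : Finset E) (P : E → Prop) [DecidablePred P] :
    IsCutLike fun X => ∑ e ∈ F, if P e then cross (p e) (q e) X else 0 := by
  refine ⟨Finset.sum_eq_zero fun e _ => by simp [cross], fun X Y => ?_, fun X Y => ?_⟩ <;>
  · simp only [← Finset.sum_add_distrib]
    refine Finset.sum_le_sum fun e _ => ?_
    by_cases hP : P e <;> by_cases h1 : p e ∈ X <;> by_cases h2 : p e ∈ Y <;>
      by_cases h3 : q e ∈ X <;> by_cases h4 : q e ∈ Y <;> simp [cross, *]

theorem isCutLike_early (p q : E → V) (F : Finset E) (τ : E → ℤ) (m : ℤ) :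
    IsCutLike (early p q F τ m) := isCutLike_sum p q F fun e => τ e ≤ m

theorem isCutLike_late (p q : E → V) (F : Finset E) (τ : E → ℤ) (m : ℤ) :
    IsCutLike (late p q F τ m) := isCutLike_sum p q F fun e => m < τ e

theorem isCutLike_cut (p q : E → V) (F : Finset E) : IsCutLike (cut p q F) := by
  have := isCutLike_sum p q F fun _ => True
  simp only [if_true] at this
  exact this

/-! ### Uncrossing -/

/-- Every subset of `U` has boundary at least two once `x` and `y` are joined to the outside
by one extra edge each. -/
def Anchored (d : Finset V → ℕ) (U : Finset V) (x y : V) : Prop :=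
  ∀ X ⊆ U, 2 ≤ d X + (if x ∈ X then 0 else 1) + (if y ∈ X then 0 else 1)

theorem Anchored.symm {d : Finset V → ℕ} {U : Finset V} {x y : V} (h : Anchored d U x y) :
    Anchored d U y x := fun X hX => by have := h X hX; omega

theorem exists_maximal_light {d : Finset V → ℕ} (hd : IsCutLike d) {U : Finset V} {u : V}
    (h1 : ∃ X ⊆ U, u ∈ X ∧ d X ≤ 1) :
    ∃ M₀ M₁ : Finset V, M₀ ⊆ M₁ ∧ M₁ ⊆ U ∧ u ∈ M₁ ∧ d M₀ = 0 ∧ d M₁ ≤ 1 ∧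
      (∀ X ⊆ U, d X = 0 → X ⊆ M₀) ∧ (∀ X ⊆ U, d X ≤ 1 → X ∩ M₁ ⊆ M₀ ∨ X ⊆ M₁) := by
  obtain ⟨M₀, hM₀, hmax₀⟩ := Finset.exists_max_image
    (U.powerset.filter fun X => d X = 0) Finset.card ⟨∅, by simp [hd.empty]⟩
  obtain ⟨X₁, hX₁, hu, hd₁⟩ := h1
  obtain ⟨M₁, hM₁, hmax₁⟩ := Finset.exists_max_image
    (U.powerset.filter fun X => u ∈ X ∧ d X ≤ 1) Finset.card ⟨X₁, by simp [*]⟩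
  simp only [Finset.mem_filter, Finset.mem_powerset, and_imp] at hM₀ hM₁ hmax₀ hmax₁
  have sub_of : ∀ X Y : Finset V, (X ∪ Y).card ≤ Y.card → X ⊆ Y := fun X Y h => by
    rw [Finset.eq_of_subset_of_card_le Finset.subset_union_right h]
    exact Finset.subset_union_left
  have hzero : ∀ X ⊆ U, d X = 0 → X ⊆ M₀ := fun X hX h0 =>
    sub_of _ _ (hmax₀ _ (Finset.union_subset hX hM₀.1)
      (by have := hd.inter_union X M₀; omega))
  have key : ∀ X ⊆ U, d (X ∪ M₁) ≤ 1 → X ⊆ M₁ := fun X hX h =>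
    sub_of _ _ (hmax₁ _ (Finset.union_subset hX hM₁.1)
      (Finset.mem_union_right _ hM₁.2.1) h)
  refine ⟨M₀, M₁, key _ hM₀.1 ?_, hM₁.1, hM₁.2.1, hM₀.2, hM₁.2.2, hzero, fun X hX h => ?_⟩
  · have := hd.inter_union M₀ M₁
    omega
  · have := hd.inter_union X M₁
    by_cases h0 : d (X ∩ M₁) = 0
    · exact Or.inl (hzero _ (Finset.inter_subset_left.trans hX) h0)
    · exact Or.inr (key X hX (by omega))

theorem anchored_of_mem_of_notMem {d : Finset V → ℕ} {U M₀ M₁ : Finset V} (h01 : M₀ ⊆ M₁)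
    (hzero : ∀ X ⊆ U, d X = 0 → X ⊆ M₀)
    (hone : ∀ X ⊆ U, d X ≤ 1 → X ∩ M₁ ⊆ M₀ ∨ X ⊆ M₁) {x y : V}
    (hx : x ∈ M₁ \ M₀) (hy : y ∉ M₁) : Anchored d U x y := by
  intro X hX
  rw [Finset.mem_sdiff] at hx
  by_contra! hlt
  rcases Nat.eq_zero_or_pos (d X) with h0 | h0
  · have hs := hzero X hX h0
    rw [if_neg fun h => hx.2 (hs h), if_neg fun h => hy (h01 (hs h))] at hlt
    omega
  · have hxX : x ∈ X := by by_contra h; rw [if_neg h] at hlt; omega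
    have hyX : y ∈ X := by by_contra h; rw [if_neg h] at hlt; omega
    rcases hone X hX (by omega) with h | h
    · exact hx.2 (h (Finset.mem_inter.2 ⟨hxX, hx.1⟩))
    · exact hy (h hyX)

theorem cross_eq_one_iff {a b : V} {X : Finset V} :
    cross a b X = 1 ↔ (a ∈ X ∧ b ∉ X) ∨ (b ∈ X ∧ a ∉ X) := by
  by_cases h1 : a ∈ X <;> by_cases h2 : b ∈ X <;> simp [cross, *]

theorem cross_le_one (a b : V) (X : Finset V) : cross a b X ≤ 1 := by
  unfold cross; split_ifs <;> omega

theorem IsCutLike.sdiff_le {d : Finset V → ℕ} (hd : IsCutLike d) {X Y : Finset V}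
    (h : d Y = 0) : d (X \ Y) ≤ d X := by
  have := hd.sdiff_sdiff X Y
  omega

/-- If `u` needs the edge `ab` in order to have boundary at least two, then `a, b` are anchored. -/
theorem anchored_of_needs_edge {d : Finset V → ℕ} (hd : IsCutLike d) {U : Finset V} {u a b : V}
    (h1 : ∃ X ⊆ U, u ∈ X ∧ d X ≤ 1) (h2 : ∀ X ⊆ U, u ∈ X → 2 ≤ d X + cross a b X) :
    Anchored d U a b := by
  obtain ⟨M₀, M₁, h01, hU, hu, hd0, hd1, hzero, hone⟩ := exists_maximal_light hd h1
  have hu0 : u ∉ M₀ := fun h => by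
    have := h2 M₀ (h01.trans hU) h
    have := cross_le_one a b M₀
    omega
  have hc1 : cross a b M₁ = 1 := by
    have := h2 M₁ hU hu
    have := cross_le_one a b M₁
    omega
  have hc2 : cross a b (M₁ \ M₀) = 1 := by
    have := h2 (M₁ \ M₀) (Finset.sdiff_subset.trans hU) (Finset.mem_sdiff.2 ⟨hu, hu0⟩)
    have := cross_le_one a b (M₁ \ M₀)
    have := hd.sdiff_le (X := M₁) hd0
    omega
  rw [cross_eq_one_iff] at hc1 hc2
  rcases hc1 with ⟨-, hb⟩ | ⟨-, ha⟩
  · rcases hc2 with ⟨h, -⟩ | ⟨h, -⟩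
    · exact anchored_of_mem_of_notMem h01 hzero hone h hb
    · exact absurd (Finset.mem_sdiff.1 h).1 hb
  · rcases hc2 with ⟨h, -⟩ | ⟨h, -⟩
    · exact absurd (Finset.mem_sdiff.1 h).1 ha
    · exact (anchored_of_mem_of_notMem h01 hzero hone h ha).symm

/-- If `u` needs the edges `ab` and `ce` in order to have boundary at least two, then some two
of their four ends are anchored. -/
theorem anchored_of_needs_edges {d : Finset V → ℕ} (hd : IsCutLike d) {U : Finset V}
    {u a b c e : V} (h1 : ∃ X ⊆ U, u ∈ X ∧ d X ≤ 1)
    (h2 : ∀ X ⊆ U, u ∈ X → 2 ≤ d X + cross a b X + cross c e X) :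
    Anchored d U a b ∨ Anchored d U c e ∨ Anchored d U a c ∨ Anchored d U a e ∨
      Anchored d U b c ∨ Anchored d U b e := by
  obtain ⟨M₀, M₁, h01, hU, hu, hd0, hd1, hzero, hone⟩ := exists_maximal_light hd h1
  by_cases hu0 : u ∈ M₀
  · have out : ∀ x y, x ∉ M₀ → y ∉ M₀ →
        (∀ X, x ∈ X → y ∈ X → cross a b (X ∪ M₀) = 0 ∧ cross c e (X ∪ M₀) = 0) →
        Anchored d U x y := by
      intro x y hx hy hc X hX
      by_contra! hlt
      rcases Nat.eq_zero_or_pos (d X) with h0 | h0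
      · have hs := hzero X hX h0
        rw [if_neg fun h => hx (hs h), if_neg fun h => hy (hs h)] at hlt
        omega
      · have hxX : x ∈ X := by by_contra h; rw [if_neg h] at hlt; omega
        have hyX : y ∈ X := by by_contra h; rw [if_neg h] at hlt; omega
        have := h2 (X ∪ M₀) (Finset.union_subset hX (h01.trans hU)) (by simp [hu0])
        have := hd.inter_union X M₀
        have := hc X hxX hyX
        omega
    have hM := h2 M₀ (h01.trans hU) hu0
    have hc1 : cross a b M₀ = 1 := by
      have := cross_le_one a b M₀
      have := cross_le_one c e M₀
      omega
    have hc2 : cross c e M₀ = 1 := by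
      have := cross_le_one c e M₀
      omega
    rw [cross_eq_one_iff] at hc1 hc2
    rcases hc1 with ⟨ha, hb⟩ | ⟨hb, ha⟩ <;> rcases hc2 with ⟨hc, he⟩ | ⟨he, hc⟩
    · have := out b e hb he fun X h h' => by simp [cross, *]
      tauto
    · have := out b c hb hc fun X h h' => by simp [cross, *]
      tauto
    · have := out a e ha he fun X h h' => by simp [cross, *]
      tauto
    · have := out a c ha hc fun X h h' => by simp [cross, *]
      tauto
  · have hc1 : cross a b M₁ = 1 ∨ cross c e M₁ = 1 := by
      have := h2 M₁ hU hu
      have := cross_le_one a b M₁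
      have := cross_le_one c e M₁
      omega
    have hc2 : cross a b (M₁ \ M₀) = 1 ∨ cross c e (M₁ \ M₀) = 1 := by
      have := h2 (M₁ \ M₀) (Finset.sdiff_subset.trans hU) (Finset.mem_sdiff.2 ⟨hu, hu0⟩)
      have := cross_le_one a b (M₁ \ M₀)
      have := cross_le_one c e (M₁ \ M₀)
      have := hd.sdiff_le (X := M₁) hd0
      omega
    have hy : a ∉ M₁ ∨ b ∉ M₁ ∨ c ∉ M₁ ∨ e ∉ M₁ := by
      simp only [cross_eq_one_iff] at hc1
      tauto
    have hx : a ∈ M₁ \ M₀ ∨ b ∈ M₁ \ M₀ ∨ c ∈ M₁ \ M₀ ∨ e ∈ M₁ \ M₀ := by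
      simp only [cross_eq_one_iff] at hc2
      tauto
    have anch : ∀ {x y}, x ∈ M₁ \ M₀ → y ∉ M₁ → Anchored d U x y :=
      anchored_of_mem_of_notMem h01 hzero hone
    rcases hx with hx | hx | hx | hx <;> rcases hy with hy | hy | hy | hy <;>
      first
        | exact absurd (Finset.mem_sdiff.1 hx).1 hy
        | (have h := anch hx hy
           have h' := h.symm
           clear * - h h'
           tauto)

end EdgeOrder

namespace EdgeOrder

variable {V E : Type} [DecidableEq V]

/-! ### Inserting a vertex into an order -/

/-- The vertices of `W` have positions `θ` and the edges of `F` times `τ` such that, once the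
edges `ab` and `cd` are added at times `k` and `l`, every subset of `W` has at least two early
edges at its first vertex and at least two late edges at its last vertex. -/
structure Admits (p q : E → V) (F : Finset E) (W : Finset V) (θ : V → ℤ) (τ : E → ℤ)
    (a b c d : V) (k l : ℤ) : Prop where
  lo : ∀ X ⊆ W, ∀ x ∈ X, (∀ y ∈ X, θ x ≤ θ y) →
    2 ≤ early p q F τ (θ x) X + (if k ≤ θ x then cross a b X else 0) +
      (if l ≤ θ x then cross c d X else 0)
  hi : ∀ X ⊆ W, ∀ x ∈ X, (∀ y ∈ X, θ y ≤ θ x) →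
    2 ≤ late p q F τ (θ x) X + (if θ x < k then cross a b X else 0) +
      (if θ x < l then cross c d X else 0)

/-- There are positions and times for the graph obtained by adding the vertex `v` and four
edges from `v` to `a`, `b`, `c` and `d`. -/
def Extends (p q : E → V) (F : Finset E) (W : Finset V) (v a b c d : V) : Prop :=
  ∃ (θ : V → ℤ) (τ : E → ℤ) (ka kb kc kd : ℤ), ∀ X ⊆ insert v W, ∀ x ∈ X,
    ((∀ y ∈ X, θ x ≤ θ y) →
      2 ≤ early p q F τ (θ x) X + (if ka ≤ θ x then cross v a X else 0) +
        (if kb ≤ θ x then cross v b X else 0) + (if kc ≤ θ x then cross v c X else 0) +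
        (if kd ≤ θ x then cross v d X else 0)) ∧
    ((∀ y ∈ X, θ y ≤ θ x) →
      2 ≤ late p q F τ (θ x) X + (if θ x < ka then cross v a X else 0) +
        (if θ x < kb then cross v b X else 0) + (if θ x < kc then cross v c X else 0) +
        (if θ x < kd then cross v d X else 0))

section

variable {p q : E → V} {F : Finset E} {W : Finset V} {v a b c d : V} {θ : V → ℤ} {τ : E → ℤ}

theorem Extends.swap_left (h : Extends p q F W v a b c d) : Extends p q F W v b a c d := by
  obtain ⟨θ, τ, ka, kb, kc, kd, h⟩ := h
  refine ⟨θ, τ, kb, ka, kc, kd, fun X hX x hx => ⟨fun hy => ?_, fun hy => ?_⟩⟩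
  · have := (h X hX x hx).1 hy; omega
  · have := (h X hX x hx).2 hy; omega

theorem Extends.swap_middle (h : Extends p q F W v a b c d) : Extends p q F W v a c b d := by
  obtain ⟨θ, τ, ka, kb, kc, kd, h⟩ := h
  refine ⟨θ, τ, ka, kc, kb, kd, fun X hX x hx => ⟨fun hy => ?_, fun hy => ?_⟩⟩
  · have := (h X hX x hx).1 hy; omega
  · have := (h X hX x hx).2 hy; omega

theorem Extends.swap_right (h : Extends p q F W v a b c d) : Extends p q F W v a b d c := by
  obtain ⟨θ, τ, ka, kb, kc, kd, h⟩ := h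
  refine ⟨θ, τ, ka, kb, kd, kc, fun X hX x hx => ⟨fun hy => ?_, fun hy => ?_⟩⟩
  · have := (h X hX x hx).1 hy; omega
  · have := (h X hX x hx).2 hy; omega

theorem Extends.swap_pairs (h : Extends p q F W v a b c d) : Extends p q F W v c d a b :=
  h.swap_middle.swap_left.swap_right.swap_middle

theorem cross_erase {a b v : V} (ha : a ≠ v) (hb : b ≠ v) (X : Finset V) :
    cross a b (X.erase v) = cross a b X := by
  simp [cross, ha, hb]

theorem cross_of_mem {v x : V} {X : Finset V} (hv : v ∈ X) :
    cross v x X = if x ∈ X then 0 else 1 := by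
  simp [cross, hv]

theorem cross_of_notMem {v x : V} {X : Finset V} (hv : v ∉ X) :
    cross v x X = if x ∈ X then 1 else 0 := by
  by_cases hx : x ∈ X <;> simp [cross, hv, hx]

theorem cross_le_add (a b : V) (X : Finset V) :
    cross a b X ≤ (if a ∈ X then 1 else 0) + (if b ∈ X then 1 else 0) := by
  by_cases ha : a ∈ X <;> by_cases hb : b ∈ X <;> simp [cross, ha, hb]

theorem cross_le_add_compl (a b : V) (X : Finset V) :
    cross a b X ≤ (if a ∈ X then 0 else 1) + (if b ∈ X then 0 else 1) := by
  by_cases ha : a ∈ X <;> by_cases hb : b ∈ X <;> simp [cross, ha, hb]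

theorem early_congr {τ' : E → ℤ} {m m' : ℤ} {X Y : Finset V}
    (h : ∀ e, τ e ≤ m ↔ τ' e ≤ m') (hc : ∀ e ∈ F, cross (p e) (q e) X = cross (p e) (q e) Y) :
    early p q F τ m X = early p q F τ' m' Y :=
  Finset.sum_congr rfl fun e he => by simp only [h e, hc e he]

theorem late_congr {τ' : E → ℤ} {m m' : ℤ} {X Y : Finset V}
    (h : ∀ e, m < τ e ↔ m' < τ' e) (hc : ∀ e ∈ F, cross (p e) (q e) X = cross (p e) (q e) Y) :
    late p q F τ m X = late p q F τ' m' Y :=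
  Finset.sum_congr rfl fun e he => by simp only [h e, hc e he]

theorem late_anti {m m' : ℤ} (h : m ≤ m') (X : Finset V) :
    late p q F τ m' X ≤ late p q F τ m X :=
  Finset.sum_le_sum fun e _ => by split_ifs <;> omega

/-- Insert `v` at position `k`, with the edges to `x₁, x₂` at time `k` and those to `y₁, y₂`
just after time `l`. -/
theorem extends_of_insert {x₁ x₂ y₁ y₂ : V} {k l : ℤ}
    (hF : ∀ e ∈ F, p e ≠ v ∧ q e ≠ v)
    (hx₁ : x₁ ≠ v) (hx₂ : x₂ ≠ v) (hy₁ : y₁ ≠ v) (hy₂ : y₂ ≠ v) (hkl : k ≤ l)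
    (lo : ∀ X ⊆ W, ∀ x ∈ X, (∀ y ∈ X, θ x ≤ θ y) → 2 ≤ early p q F τ (θ x) X +
      (if k ≤ θ x then (if x₁ ∈ X then 1 else 0) + (if x₂ ∈ X then 1 else 0) else 0) +
      (if l ≤ θ x then (if y₁ ∈ X then 1 else 0) + (if y₂ ∈ X then 1 else 0) else 0))
    (hi : ∀ X ⊆ W, ∀ x ∈ X, (∀ y ∈ X, θ y ≤ θ x) → 2 ≤ late p q F τ (θ x) X +
      (if θ x < k then (if x₁ ∈ X then 1 else 0) + (if x₂ ∈ X then 1 else 0) else 0) +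
      (if θ x < l then (if y₁ ∈ X then 1 else 0) + (if y₂ ∈ X then 1 else 0) else 0))
    (hi' : ∀ X ⊆ W, ∀ x ∈ X, (∀ y ∈ X, θ y ≤ θ x) → k ≤ θ x →
      2 ≤ late p q F τ (θ x) X + (if θ x < l then cross y₁ y₂ X else 0))
    (h1 : Anchored (early p q F τ k) (W.filter (k ≤ θ ·)) x₁ x₂)
    (h2 : Anchored (late p q F τ k) (W.filter (θ · < k)) y₁ y₂) :
    Extends p q F W v x₁ x₂ y₁ y₂ := by
  set θ' : V → ℤ := fun y => if y = v then k else if θ y < k then θ y else θ y + 1 with hθ'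
  set τ' : E → ℤ := fun e => if τ e ≤ k then τ e else τ e + 1 with hτ'
  have hv : θ' v = k := by simp [hθ']
  have hlt : ∀ y, y ≠ v → θ y < k → θ' y = θ y := fun y h h' => by simp [hθ', h, h']
  have hge : ∀ y, y ≠ v → k ≤ θ y → θ' y = θ y + 1 := fun y h h' => by
    simp [hθ', h, not_lt.2 h']
  have hmono : ∀ y z, y ≠ v → z ≠ v → θ' y ≤ θ' z → θ y ≤ θ z := fun y z hy hz h => by
    simp only [hθ', hy, hz, if_false] at h
    split_ifs at h <;> omega
  have hlt' : ∀ y, y ≠ v → θ' y ≤ k → θ y < k := fun y hy h => by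
    simp only [hθ', hy, if_false] at h
    split_ifs at h <;> omega
  have hge' : ∀ y, y ≠ v → k ≤ θ' y → k ≤ θ y := fun y hy h => by
    simp only [hθ', hy, if_false] at h
    split_ifs at h <;> omega
  have hc : ∀ X : Finset V, ∀ e ∈ F, cross (p e) (q e) X = cross (p e) (q e) (X.erase v) :=
    fun X e he => (cross_erase (hF e he).1 (hF e he).2 X).symm
  have early_lt : ∀ m X, m ≤ k → early p q F τ' m X = early p q F τ m (X.erase v) :=
    fun m X hm => early_congr (fun e => by simp only [hτ']; split_ifs <;> omega) (hc X)
  have early_ge : ∀ m X, k ≤ m → early p q F τ' (m + 1) X = early p q F τ m (X.erase v) :=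
    fun m X hm => early_congr (fun e => by simp only [hτ']; split_ifs <;> omega) (hc X)
  have late_lt : ∀ m X, m ≤ k → late p q F τ' m X = late p q F τ m (X.erase v) :=
    fun m X hm => late_congr (fun e => by simp only [hτ']; split_ifs <;> omega) (hc X)
  have late_ge : ∀ m X, k ≤ m → late p q F τ' (m + 1) X = late p q F τ m (X.erase v) :=
    fun m X hm => late_congr (fun e => by simp only [hτ']; split_ifs <;> omega) (hc X)
  refine ⟨θ', τ', k, k, l + 1, l + 1, fun X hX x hx => ?_⟩
  have hXW : X.erase v ⊆ W := fun y hy => by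
    have := hX (Finset.mem_of_mem_erase hy)
    exact (Finset.mem_insert.1 this).resolve_left (Finset.ne_of_mem_erase hy)
  have hmem : ∀ {y}, y ≠ v → (y ∈ X.erase v ↔ y ∈ X) := fun h => by simp [h]
  by_cases hvX : v ∈ X
  · rw [cross_of_mem hvX, cross_of_mem hvX, cross_of_mem hvX, cross_of_mem hvX]
    by_cases hxv : x = v
    · subst hxv
      rw [hv]
      refine ⟨fun hmin => ?_, fun hmax => ?_⟩
      · have := h1 (X.erase x) fun y hy => Finset.mem_filter.2 ⟨hXW hy,
          hge' y (Finset.ne_of_mem_erase hy) (hmin y (Finset.mem_of_mem_erase hy))⟩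
        rw [early_lt _ _ le_rfl]
        simp only [hmem hx₁, hmem hx₂] at this
        rw [if_pos le_rfl, if_pos le_rfl]
        omega
      · have := h2 (X.erase x) fun y hy => Finset.mem_filter.2 ⟨hXW hy,
          hlt' y (Finset.ne_of_mem_erase hy) (hmax y (Finset.mem_of_mem_erase hy))⟩
        rw [late_lt _ _ le_rfl]
        simp only [hmem hy₁, hmem hy₂] at this
        rw [if_pos (show k < l + 1 by omega), if_pos (show k < l + 1 by omega)]
        omega
    · have hxX : x ∈ X.erase v := (hmem hxv).2 hx
      refine ⟨fun hmin => ?_, fun hmax => ?_⟩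
      · have hk := hlt' x hxv (hv ▸ hmin v hvX)
        have := lo _ hXW x hxX fun y hy => hmono _ _ hxv (Finset.ne_of_mem_erase hy)
          (hmin y (Finset.mem_of_mem_erase hy))
        rw [if_neg (by omega), if_neg (by omega)] at this
        rw [hlt x hxv hk, early_lt _ _ hk.le]
        omega
      · have hk := hge' x hxv (hv ▸ hmax v hvX)
        have := hi' _ hXW x hxX (fun y hy => hmono _ _ (Finset.ne_of_mem_erase hy) hxv
          (hmax y (Finset.mem_of_mem_erase hy))) hk
        have hle := cross_le_add_compl y₁ y₂ (X.erase v)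
        simp only [hmem hy₁, hmem hy₂] at hle
        rw [hge x hxv hk, late_ge _ _ hk]
        by_cases hl : θ x < l
        · rw [if_pos hl] at this
          rw [if_pos (show θ x + 1 < l + 1 by omega), if_pos (show θ x + 1 < l + 1 by omega)]
          omega
        · rw [if_neg hl] at this
          omega
  · have hXe : X.erase v = X := Finset.erase_eq_of_notMem hvX
    have hxv : x ≠ v := fun h => hvX (h ▸ hx)
    have hne : ∀ y ∈ X, y ≠ v := fun y hy h => hvX (h ▸ hy)
    rw [hXe] at hXW
    rw [cross_of_notMem hvX, cross_of_notMem hvX, cross_of_notMem hvX, cross_of_notMem hvX]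
    refine ⟨fun hmin => ?_, fun hmax => ?_⟩
    · have := lo _ hXW x hx fun y hy => hmono _ _ hxv (hne y hy) (hmin y hy)
      rcases lt_or_ge (θ x) k with hk | hk
      · rw [hlt x hxv hk, early_lt _ _ hk.le, hXe]
        rw [if_neg (by omega), if_neg (by omega)] at this
        omega
      · rw [hge x hxv hk, early_ge _ _ hk, hXe]
        rw [if_pos hk] at this
        rw [if_pos (show k ≤ θ x + 1 by omega), if_pos (show k ≤ θ x + 1 by omega)]
        by_cases hl : l ≤ θ x
        · rw [if_pos hl] at this
          rw [if_pos (show l + 1 ≤ θ x + 1 by omega), if_pos (show l + 1 ≤ θ x + 1 by omega)]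
          omega
        · rw [if_neg hl] at this
          omega
    · have := hi _ hXW x hx fun y hy => hmono _ _ (hne y hy) hxv (hmax y hy)
      rcases lt_or_ge (θ x) k with hk | hk
      · rw [hlt x hxv hk, late_lt _ _ hk.le, hXe]
        rw [if_pos hk, if_pos (show θ x < l by omega)] at this
        rw [if_pos hk, if_pos hk, if_pos (show θ x < l + 1 by omega),
          if_pos (show θ x < l + 1 by omega)]
        omega
      · rw [hge x hxv hk, late_ge _ _ hk, hXe]
        rw [if_neg (by omega)] at this
        by_cases hl : θ x < l
        · rw [if_pos hl] at this
          rw [if_pos (show θ x + 1 < l + 1 by omega), if_pos (show θ x + 1 < l + 1 by omega)]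
          omega
        · rw [if_neg hl] at this
          omega

theorem Admits.swap {k l : ℤ} (h : Admits p q F W θ τ a b c d k l) :
    Admits p q F W θ τ c d a b l k where
  lo X hX x hx hy := by have := h.lo X hX x hx hy; omega
  hi X hX x hx hy := by have := h.hi X hX x hx hy; omega

theorem Admits.reverse {k l : ℤ} (h : Admits p q F W θ τ a b c d k l) :
    Admits p q F W (fun x => -θ x) (fun e => 1 - τ e) a b c d (1 - k) (1 - l) where
  lo X hX x hx hy := by
    have := h.hi X hX x hx fun y hyX => by have := hy y hyX; omega
    have e1 : early p q F (fun e => 1 - τ e) (-θ x) X = late p q F τ (θ x) X :=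
      Finset.sum_congr rfl fun e he => by
        simp only [show 1 - τ e ≤ -θ x ↔ θ x < τ e by omega]
    simp only [show (1 - k ≤ -θ x) ↔ θ x < k by omega, show (1 - l ≤ -θ x) ↔ θ x < l by omega]
    omega
  hi X hX x hx hy := by
    have := h.lo X hX x hx fun y hyX => by have := hy y hyX; omega
    have e1 : late p q F (fun e => 1 - τ e) (-θ x) X = early p q F τ (θ x) X :=
      Finset.sum_congr rfl fun e he => by
        simp only [show -θ x < 1 - τ e ↔ τ e ≤ θ x by omega]
    simp only [show -θ x < 1 - k ↔ k ≤ θ x by omega, show -θ x < 1 - l ↔ l ≤ θ x by omega]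
    omega

end

end EdgeOrder

namespace EdgeOrder

variable {V E : Type} [DecidableEq V]

section

variable {p q : E → V} {F : Finset E} {W : Finset V} {v a b c d : V} {θ : V → ℤ} {τ : E → ℤ}

/-- A weakening of `Admits` at equal times that is symmetric in the four ends. -/
structure AdmitsWeakly (p q : E → V) (F : Finset E) (W : Finset V) (θ : V → ℤ) (τ : E → ℤ)
    (a b c d : V) (k : ℤ) : Prop where
  lo : ∀ X ⊆ W, ∀ x ∈ X, (∀ y ∈ X, θ x ≤ θ y) →
    2 ≤ early p q F τ (θ x) X + (if k ≤ θ x then (if a ∈ X then 1 else 0) +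
      (if b ∈ X then 1 else 0) + (if c ∈ X then 1 else 0) + (if d ∈ X then 1 else 0) else 0)
  hi : ∀ X ⊆ W, ∀ x ∈ X, (∀ y ∈ X, θ y ≤ θ x) →
    2 ≤ late p q F τ (θ x) X + (if θ x < k then (if a ∈ X then 1 else 0) +
      (if b ∈ X then 1 else 0) + (if c ∈ X then 1 else 0) + (if d ∈ X then 1 else 0) else 0)

theorem Admits.weakly {k : ℤ} (h : Admits p q F W θ τ a b c d k k) :
    AdmitsWeakly p q F W θ τ a b c d k where
  lo X hX x hx hy := by
    have := h.lo X hX x hx hy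
    have := cross_le_add a b X
    have := cross_le_add c d X
    by_cases hk : k ≤ θ x
    · simp only [if_pos hk] at *
      omega
    · simp only [if_neg hk] at *
      omega
  hi X hX x hx hy := by
    have := h.hi X hX x hx hy
    have := cross_le_add a b X
    have := cross_le_add c d X
    by_cases hk : θ x < k
    · simp only [if_pos hk] at *
      omega
    · simp only [if_neg hk] at *
      omega

theorem AdmitsWeakly.swap_left {k : ℤ} (h : AdmitsWeakly p q F W θ τ a b c d k) :
    AdmitsWeakly p q F W θ τ b a c d k where
  lo X hX x hx hy := by simpa only [add_comm, add_left_comm] using h.lo X hX x hx hy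
  hi X hX x hx hy := by simpa only [add_comm, add_left_comm] using h.hi X hX x hx hy

theorem AdmitsWeakly.swap_middle {k : ℤ} (h : AdmitsWeakly p q F W θ τ a b c d k) :
    AdmitsWeakly p q F W θ τ a c b d k where
  lo X hX x hx hy := by simpa only [add_comm, add_left_comm] using h.lo X hX x hx hy
  hi X hX x hx hy := by simpa only [add_comm, add_left_comm] using h.hi X hX x hx hy

theorem AdmitsWeakly.swap_right {k : ℤ} (h : AdmitsWeakly p q F W θ τ a b c d k) :
    AdmitsWeakly p q F W θ τ a b d c k where
  lo X hX x hx hy := by simpa only [add_comm, add_left_comm] using h.lo X hX x hx hy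
  hi X hX x hx hy := by simpa only [add_comm, add_left_comm] using h.hi X hX x hx hy

theorem AdmitsWeakly.swap_pairs {k : ℤ} (h : AdmitsWeakly p q F W θ τ a b c d k) :
    AdmitsWeakly p q F W θ τ c d a b k :=
  h.swap_middle.swap_left.swap_right.swap_middle

theorem extends_of_anchored {k : ℤ} (hF : ∀ e ∈ F, p e ≠ v ∧ q e ≠ v)
    (hne : a ≠ v ∧ b ≠ v ∧ c ≠ v ∧ d ≠ v) (h : AdmitsWeakly p q F W θ τ a b c d k)
    (h1 : Anchored (early p q F τ k) (W.filter (k ≤ θ ·)) a b)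
    (h2 : Anchored (late p q F τ k) (W.filter (θ · < k)) c d) : Extends p q F W v a b c d := by
  refine extends_of_insert hF hne.1 hne.2.1 hne.2.2.1 hne.2.2.2 le_rfl
    (fun X hX x hx hy => ?_) (fun X hX x hx hy => ?_) (fun X hX x hx hy hk => ?_) h1 h2
  · have := h.lo X hX x hx hy
    split_ifs at this ⊢ <;> omega
  · have := h.hi X hX x hx hy
    split_ifs at this ⊢ <;> omega
  · have := h.hi X hX x hx hy
    rw [if_neg (not_lt.2 hk)] at this
    omega

/-- At least three of `a, b, c, d` have the property `S`. -/
def ThreeOf (S : V → Prop) (a b c d : V) : Prop :=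
  (S a ∧ S b ∧ S c) ∨ (S a ∧ S b ∧ S d) ∨ (S a ∧ S c ∧ S d) ∨ (S b ∧ S c ∧ S d)

theorem ThreeOf.mono {V : Type} {S T : V → Prop} {a b c d : V} (hST : ∀ x, S x → T x) (h : ThreeOf S a b c d) :
    ThreeOf T a b c d := by
  have := hST a
  have := hST b
  have := hST c
  have := hST d
  unfold ThreeOf at *
  tauto

theorem ThreeOf.swap_left {V : Type} {S : V → Prop} {a b c d : V}
    (h : ThreeOf S a b c d) : ThreeOf S b a c d := by
  unfold ThreeOf at *
  tauto

theorem ThreeOf.swap_middle {V : Type} {S : V → Prop} {a b c d : V}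
    (h : ThreeOf S a b c d) : ThreeOf S a c b d := by
  unfold ThreeOf at *
  tauto

theorem ThreeOf.swap_right {V : Type} {S : V → Prop} {a b c d : V}
    (h : ThreeOf S a b c d) : ThreeOf S a b d c := by
  unfold ThreeOf at *
  tauto

theorem extends_of_disjoint {k : ℤ} (hF : ∀ e ∈ F, p e ≠ v ∧ q e ≠ v)
    (hne : a ≠ v ∧ b ≠ v ∧ c ≠ v ∧ d ≠ v) (h : AdmitsWeakly p q F W θ τ a b c d k)
    {S T : V → Prop} (hST : ∀ x, S x → ¬ T x)
    (hS : ¬ ThreeOf S a b c d) (hT : ¬ ThreeOf T a b c d)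
    (h1 : ∀ x y, ¬ S x → ¬ S y → Anchored (early p q F τ k) (W.filter (k ≤ θ ·)) x y)
    (h2 : ∀ x y, ¬ T x → ¬ T y → Anchored (late p q F τ k) (W.filter (θ · < k)) x y) :
    Extends p q F W v a b c d := by
  have key : (((¬ S a ∧ ¬ S b) ∧ ¬ T c ∧ ¬ T d) ∨ ((¬ S c ∧ ¬ S d) ∧ ¬ T a ∧ ¬ T b)) ∨
      (((¬ S a ∧ ¬ S c) ∧ ¬ T b ∧ ¬ T d) ∨ ((¬ S b ∧ ¬ S d) ∧ ¬ T a ∧ ¬ T c)) ∨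
      (((¬ S a ∧ ¬ S d) ∧ ¬ T b ∧ ¬ T c) ∨ ((¬ S b ∧ ¬ S c) ∧ ¬ T a ∧ ¬ T d)) := by
    have ha := hST a
    have hb := hST b
    have hc := hST c
    have hd := hST d
    unfold ThreeOf at hS hT
    clear * - ha hb hc hd hS hT
    by_cases S a <;> by_cases S b <;> by_cases S c <;> by_cases S d <;> simp_all <;> tauto
  have core : ∀ {a b c d : V}, a ≠ v ∧ b ≠ v ∧ c ≠ v ∧ d ≠ v →
      AdmitsWeakly p q F W θ τ a b c d k →
      ((¬ S a ∧ ¬ S b) ∧ ¬ T c ∧ ¬ T d) ∨ ((¬ S c ∧ ¬ S d) ∧ ¬ T a ∧ ¬ T b) →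
      Extends p q F W v a b c d := by
    rintro a b c d ⟨ha, hb, hc, hd⟩ h (⟨⟨h3, h4⟩, h5, h6⟩ | ⟨⟨h3, h4⟩, h5, h6⟩)
    · exact extends_of_anchored hF ⟨ha, hb, hc, hd⟩ h (h1 _ _ h3 h4) (h2 _ _ h5 h6)
    · exact (extends_of_anchored hF ⟨hc, hd, ha, hb⟩ h.swap_pairs (h1 _ _ h3 h4)
        (h2 _ _ h5 h6)).swap_pairs
  obtain ⟨ha, hb, hc, hd⟩ := hne
  rcases key with hk | hk | hk
  · exact core ⟨ha, hb, hc, hd⟩ h hk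
  · exact (core ⟨ha, hc, hb, hd⟩ h.swap_middle hk).swap_middle
  · exact (core ⟨ha, hd, hb, hc⟩ h.swap_right.swap_middle hk).swap_middle.swap_right

theorem anchored_of_notMem {d : Finset V → ℕ} {U : Finset V} {x y : V} (hx : x ∉ U)
    (hy : y ∉ U) : Anchored d U x y := fun X hX => by
  rw [if_neg fun h => hx (hX h), if_neg fun h => hy (hX h)]
  omega

theorem Anchored.of_notMem {d : Finset V → ℕ} {U : Finset V} {x y z : V}
    (h : Anchored d U x y) (hz : z ∉ U) : Anchored d U x z := fun X hX => by
  have := h X hX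
  rw [if_neg fun h => hz (hX h)]
  split_ifs at this ⊢ <;> omega

theorem extends_of_anchored_of_threeOf {k : ℤ} (hF : ∀ e ∈ F, p e ≠ v ∧ q e ≠ v)
    (hne : a ≠ v ∧ b ≠ v ∧ c ≠ v ∧ d ≠ v) (h : AdmitsWeakly p q F W θ τ a b c d k)
    (h1 : Anchored (early p q F τ k) (W.filter (k ≤ θ ·)) a b)
    (h3 : ThreeOf (· ∈ W.filter (k ≤ θ ·)) a b c d) : Extends p q F W v a b c d := by
  have hdisj : ∀ x ∈ W.filter (k ≤ θ ·), x ∉ W.filter (θ · < k) := fun x hx hx' => by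
    have := (Finset.mem_filter.1 hx).2
    have := (Finset.mem_filter.1 hx').2
    omega
  obtain ⟨ha, hb, hc, hd⟩ := hne
  unfold ThreeOf at h3
  by_cases hdU : d ∈ W.filter (k ≤ θ ·)
  · by_cases hcU : c ∈ W.filter (k ≤ θ ·)
    · exact extends_of_anchored hF ⟨ha, hb, hc, hd⟩ h h1
        (anchored_of_notMem (hdisj _ hcU) (hdisj _ hdU))
    · refine (extends_of_anchored hF ⟨ha, hc, hb, hd⟩ h.swap_middle (h1.of_notMem hcU)
        (anchored_of_notMem (hdisj _ ?_) (hdisj _ hdU))).swap_middle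
      tauto
  · refine (extends_of_anchored hF ⟨ha, hd, hb, hc⟩ h.swap_right.swap_middle
      (h1.of_notMem hdU) (anchored_of_notMem (hdisj _ ?_) (hdisj _ ?_))).swap_middle.swap_right
    all_goals tauto

theorem extends_of_admits_of_threeOf {k : ℤ} (hF : ∀ e ∈ F, p e ≠ v ∧ q e ≠ v)
    (hne : a ≠ v ∧ b ≠ v ∧ c ≠ v ∧ d ≠ v) (h : Admits p q F W θ τ a b c d k k)
    (h3 : ThreeOf (· ∈ W.filter (k ≤ θ ·)) a b c d) : Extends p q F W v a b c d := by
  obtain ⟨k, ⟨h, h3⟩, hmax⟩ := Int.exists_greatest_of_bdd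
    (P := fun k => Admits p q F W θ τ a b c d k k ∧ ThreeOf (· ∈ W.filter (k ≤ θ ·)) a b c d)
    ⟨∑ x ∈ W, |θ x|, fun k hk => by
      have : ∃ x ∈ W, k ≤ θ x := by
        rcases hk.2 with ⟨h, -⟩ | ⟨h, -⟩ | ⟨h, -⟩ | ⟨h, -⟩ <;> exact ⟨_, Finset.mem_filter.1 h⟩
      obtain ⟨x, hx, hkx⟩ := this
      exact (hkx.trans (le_abs_self _)).trans
        (Finset.single_le_sum (f := fun x => |θ x|) (fun _ _ => abs_nonneg _) hx)⟩ ⟨k, h, h3⟩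
  by_cases hk : Admits p q F W θ τ a b c d (k + 1) (k + 1)
  · refine extends_of_disjoint hF hne h.weakly (S := (· ∈ W.filter (k + 1 ≤ θ ·)))
      (T := (· ∈ W.filter (θ · < k))) (fun x hx hx' => ?_) (fun h3' => ?_) (fun h3' => ?_)
      (fun x y hx hy X hX => ?_) (fun x y hx hy => anchored_of_notMem hx hy)
    · have := (Finset.mem_filter.1 hx).2
      have := (Finset.mem_filter.1 hx').2
      omega
    · have := hmax _ ⟨hk, h3'⟩
      omega
    · have h4 : ThreeOf (fun x => ¬ x ∈ W.filter (k ≤ θ ·)) a b c d :=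
        h3'.mono fun x hx hx' => by
          have := (Finset.mem_filter.1 hx).2
          have := (Finset.mem_filter.1 hx').2
          omega
      unfold ThreeOf at h3 h4
      clear * - h3 h4
      tauto
    · by_cases hu : ∃ u ∈ X, θ u = k
      · obtain ⟨u, hu, rfl⟩ := hu
        have := hk.lo X (fun y hy => (Finset.mem_filter.1 (hX hy)).1) u hu
          fun y hy => (Finset.mem_filter.1 (hX hy)).2
        rw [if_neg (by omega), if_neg (by omega)] at this
        omega
      · have hsub : X ⊆ W.filter (k + 1 ≤ θ ·) := fun y hy => by
          have h5 := Finset.mem_filter.1 (hX hy)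
          have h6 : θ y ≠ k := fun h => hu ⟨y, hy, h⟩
          exact Finset.mem_filter.2 ⟨h5.1, by omega⟩
        exact anchored_of_notMem hx hy X hsub
  · have : ∃ X ⊆ W, ∃ x ∈ X, (∀ y ∈ X, θ x ≤ θ y) ∧ θ x = k ∧ early p q F τ k X ≤ 1 := by
      by_contra! hcon
      refine hk ⟨fun X hX x hx hy => ?_, fun X hX x hx hy => ?_⟩
      · have h1 := h.lo X hX x hx hy
        have h2 := hcon X hX x hx hy
        by_cases hxk : θ x = k
        · have := h2 hxk
          rw [hxk]
          omega
        · simp only [show k + 1 ≤ θ x ↔ k ≤ θ x by omega]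
          exact h1
      · have h1 := h.hi X hX x hx hy
        split_ifs at h1 ⊢ <;> omega
    obtain ⟨X, hX, u, hu, hmin, huk, hle⟩ := this
    have hmain := anchored_of_needs_edges (isCutLike_early p q F τ k) (U := W.filter (k ≤ θ ·))
      (u := u) (a := a) (b := b) (c := c) (e := d)
      ⟨X, fun y hy => Finset.mem_filter.2 ⟨hX hy, huk ▸ hmin y hy⟩, hu, hle⟩
      fun Y hY huY => by
        have := h.lo Y (fun y hy => (Finset.mem_filter.1 (hY hy)).1) u huY
          fun y hy => huk ▸ (Finset.mem_filter.1 (hY hy)).2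
        rwa [if_pos huk.ge, if_pos huk.ge, huk] at this
    have h := h.weakly
    obtain ⟨ha, hb, hc, hd⟩ := hne
    rcases hmain with h1 | h1 | h1 | h1 | h1 | h1
    · exact extends_of_anchored_of_threeOf hF ⟨ha, hb, hc, hd⟩ h h1 h3
    · exact (extends_of_anchored_of_threeOf hF ⟨hc, hd, ha, hb⟩ h.swap_pairs h1
        h3.swap_middle.swap_left.swap_right.swap_middle).swap_pairs
    · exact (extends_of_anchored_of_threeOf hF ⟨ha, hc, hb, hd⟩ h.swap_middle h1
        h3.swap_middle).swap_middle
    · exact (extends_of_anchored_of_threeOf hF ⟨ha, hd, hb, hc⟩ h.swap_right.swap_middle h1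
        h3.swap_right.swap_middle).swap_middle.swap_right
    · exact (extends_of_anchored_of_threeOf hF ⟨hb, hc, ha, hd⟩ h.swap_left.swap_middle h1
        h3.swap_left.swap_middle).swap_middle.swap_left
    · exact (extends_of_anchored_of_threeOf hF ⟨hb, hd, ha, hc⟩
        h.swap_left.swap_right.swap_middle h1
        h3.swap_left.swap_right.swap_middle).swap_middle.swap_right.swap_left

theorem extends_of_admits_same {k : ℤ} (hF : ∀ e ∈ F, p e ≠ v ∧ q e ≠ v)
    (hne : a ≠ v ∧ b ≠ v ∧ c ≠ v ∧ d ≠ v) (h : Admits p q F W θ τ a b c d k k) :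
    Extends p q F W v a b c d := by
  by_cases h3 : ThreeOf (· ∈ W.filter (k ≤ θ ·)) a b c d
  · exact extends_of_admits_of_threeOf hF hne h h3
  by_cases h4 : ThreeOf (· ∈ W.filter (θ · < k)) a b c d
  · refine extends_of_admits_of_threeOf hF hne h.reverse (h4.mono fun x hx => ?_)
    rw [Finset.mem_filter] at hx ⊢
    exact ⟨hx.1, by omega⟩
  · exact extends_of_disjoint hF hne h.weakly (fun x hx hx' => by
      have := (Finset.mem_filter.1 hx).2
      have := (Finset.mem_filter.1 hx').2
      omega) h3 h4 (fun _ _ => anchored_of_notMem) (fun _ _ => anchored_of_notMem)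

theorem extends_of_admits_add (hF : ∀ e ∈ F, p e ≠ v ∧ q e ≠ v)
    (hne : a ≠ v ∧ b ≠ v ∧ c ≠ v ∧ d ≠ v) (n : ℕ) :
    ∀ k : ℤ, Admits p q F W θ τ a b c d k (k + n) → Extends p q F W v a b c d := by
  induction n with
  | zero => exact fun k h => extends_of_admits_same hF hne (by simpa using h)
  | succ n ih =>
    intro k h
    set l : ℤ := k + n with hl
    rw [show k + (n + 1 : ℕ) = l + 1 by push_cast; omega] at h
    by_cases hA : Admits p q F W θ τ a b c d (k + 1) (l + 1)
    · exact ih (k + 1) (by convert hA using 1; omega)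
    by_cases hB : Admits p q F W θ τ a b c d k l
    · exact ih k hB
    have hX : ∃ X ⊆ W, ∃ x ∈ X, (∀ y ∈ X, θ x ≤ θ y) ∧ θ x = k ∧ early p q F τ k X ≤ 1 := by
      by_contra! hcon
      refine hA ⟨fun X hX x hx hy => ?_, fun X hX x hx hy => ?_⟩
      · have h1 := h.lo X hX x hx hy
        have h2 := hcon X hX x hx hy
        by_cases hxk : θ x = k
        · have := h2 hxk
          rw [hxk]
          omega
        · simp only [show k + 1 ≤ θ x ↔ k ≤ θ x by omega]
          exact h1
      · have h1 := h.hi X hX x hx hy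
        split_ifs at h1 ⊢ <;> omega
    have hY : ∃ X ⊆ W, ∃ x ∈ X, (∀ y ∈ X, θ y ≤ θ x) ∧ θ x = l ∧ late p q F τ l X ≤ 1 := by
      by_contra! hcon
      refine hB ⟨fun X hX x hx hy => ?_, fun X hX x hx hy => ?_⟩
      · have h1 := h.lo X hX x hx hy
        split_ifs at h1 ⊢ <;> omega
      · have h1 := h.hi X hX x hx hy
        have h2 := hcon X hX x hx hy
        by_cases hxk : θ x = l
        · have := h2 hxk
          rw [hxk]
          omega
        · simp only [show θ x < l ↔ θ x < l + 1 by omega]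
          exact h1
    obtain ⟨X, hX, u, hu, hmin, huk, hle⟩ := hX
    obtain ⟨Y, hY, w, hw, hmax, hwl, hle'⟩ := hY
    have h1 : Anchored (early p q F τ k) (W.filter (k ≤ θ ·)) a b :=
      anchored_of_needs_edge (isCutLike_early p q F τ k) (u := u)
        ⟨X, fun y hy => Finset.mem_filter.2 ⟨hX hy, huk ▸ hmin y hy⟩, hu, hle⟩
        fun Z hZ huZ => by
          have := h.lo Z (fun y hy => (Finset.mem_filter.1 (hZ hy)).1) u huZ
            fun y hy => huk ▸ (Finset.mem_filter.1 (hZ hy)).2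
          rwa [if_pos huk.ge, if_neg (by omega), huk] at this
    have h2 : Anchored (late p q F τ l) (W.filter (θ · ≤ l)) c d :=
      anchored_of_needs_edge (isCutLike_late p q F τ l) (u := w)
        ⟨Y, fun y hy => Finset.mem_filter.2 ⟨hY hy, hwl ▸ hmax y hy⟩, hw, hle'⟩
        fun Z hZ huZ => by
          have := h.hi Z (fun y hy => (Finset.mem_filter.1 (hZ hy)).1) w huZ
            fun y hy => hwl ▸ (Finset.mem_filter.1 (hZ hy)).2
          rwa [if_neg (by omega), if_pos (show θ w < l + 1 by omega), hwl] at this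
    refine extends_of_insert hF hne.1 hne.2.1 hne.2.2.1 hne.2.2.2
      (show k ≤ l + 1 by omega) (fun X hX x hx hy => ?_) (fun X hX x hx hy => ?_)
      (fun X hX x hx hy hk => ?_) h1 fun Z hZ => ?_
    · have := h.lo X hX x hx hy
      have := cross_le_add a b X
      have := cross_le_add c d X
      split_ifs at * <;> omega
    · have := h.hi X hX x hx hy
      have := cross_le_add a b X
      have := cross_le_add c d X
      split_ifs at * <;> omega
    · have := h.hi X hX x hx hy
      rwa [if_neg (not_lt.2 hk)] at this
    · have := h2 Z fun y hy => by
        have := Finset.mem_filter.1 (hZ hy)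
        exact Finset.mem_filter.2 ⟨this.1, by omega⟩
      have := late_anti (p := p) (q := q) (F := F) (τ := τ) (show k ≤ l by omega) Z
      omega

/-- An order can be extended along the pinching of two edges `ab` and `cd` into `v`. -/
theorem extends_of_admits {k l : ℤ} (hF : ∀ e ∈ F, p e ≠ v ∧ q e ≠ v)
    (hne : a ≠ v ∧ b ≠ v ∧ c ≠ v ∧ d ≠ v) (h : Admits p q F W θ τ a b c d k l) :
    Extends p q F W v a b c d := by
  rcases le_total k l with hkl | hkl
  · refine extends_of_admits_add (θ := θ) (τ := τ) hF hne (l - k).toNat k ?_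
    rwa [Int.toNat_of_nonneg (by omega), add_sub_cancel]
  · obtain ⟨ha, hb, hc, hd⟩ := hne
    refine (extends_of_admits_add (θ := θ) (τ := τ) hF ⟨hc, hd, ha, hb⟩ (k - l).toNat l ?_).swap_pairs
    rw [Int.toNat_of_nonneg (by omega), add_sub_cancel]
    exact h.swap

end

end EdgeOrder

namespace EdgeOrder

variable {V E : Type} [DecidableEq V]

/-! ### Existence of an order -/

/-- Every nonempty subset of `W` has at least four boundary edges. -/
def FourCut (p q : E → V) (F : Finset E) (W : Finset V) : Prop :=
  ∀ X ⊆ W, X.Nonempty → 4 ≤ cut p q F X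

/-- The vertices of `W` have positions `θ` and the edges of `F` times `τ` such that every subset
of `W` has at least two early edges at its first vertex and at least two late edges at its last
vertex. -/
def Ordered (p q : E → V) (F : Finset E) (W : Finset V) (θ : V → ℤ) (τ : E → ℤ) : Prop :=
  ∀ X ⊆ W, ∀ x ∈ X, ((∀ y ∈ X, θ x ≤ θ y) → 2 ≤ early p q F τ (θ x) X) ∧
    ((∀ y ∈ X, θ y ≤ θ x) → 2 ≤ late p q F τ (θ x) X)

theorem Ordered.mono {p q : E → V} {F F' : Finset E} {W : Finset V} {θ : V → ℤ} {τ : E → ℤ}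
    (h : Ordered p q F W θ τ) (hF : F ⊆ F') : Ordered p q F' W θ τ := fun X hX x hx =>
  ⟨fun hy => ((h X hX x hx).1 hy).trans
      (Finset.sum_le_sum_of_subset_of_nonneg hF fun _ _ _ => Nat.zero_le _),
    fun hy => ((h X hX x hx).2 hy).trans
      (Finset.sum_le_sum_of_subset_of_nonneg hF fun _ _ _ => Nat.zero_le _)⟩

theorem even_cross (a b : V) (X Y : Finset V) :
    2 ∣ cross a b (X ∩ Y) + cross a b (X \ Y) + cross a b X := by
  by_cases h1 : a ∈ X <;> by_cases h2 : b ∈ X <;> by_cases h3 : a ∈ Y <;>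
    by_cases h4 : b ∈ Y <;> simp [cross, *]

theorem even_cut (p q : E → V) (F : Finset E) (X Y : Finset V) :
    2 ∣ cut p q F (X ∩ Y) + cut p q F (X \ Y) + cut p q F X := by
  simp only [cut, ← Finset.sum_add_distrib]
  exact Finset.dvd_sum fun e _ => even_cross _ _ _ _

theorem separates_of_light {p q : E → V} {F : Finset E} {X : Finset V} {a b c d : V}
    (hin : 4 ≤ cut p q F X + (if a ∈ X then 1 else 0) + (if b ∈ X then 1 else 0) +
      (if c ∈ X then 1 else 0) + (if d ∈ X then 1 else 0))
    (hout : 4 ≤ cut p q F X + (if a ∈ X then 0 else 1) + (if b ∈ X then 0 else 1) +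
      (if c ∈ X then 0 else 1) + (if d ∈ X then 0 else 1))
    (hX : cut p q F X + cross a b X + cross c d X < 4) :
    cut p q F X ≤ 3 ∧ ((a ∈ X ∧ b ∈ X ∧ c ∉ X ∧ d ∉ X) ∨ (a ∉ X ∧ b ∉ X ∧ c ∈ X ∧ d ∈ X)) := by
  refine ⟨by omega, ?_⟩
  by_cases ha : a ∈ X <;> by_cases hb : b ∈ X <;> by_cases hc : c ∈ X <;>
    by_cases hd : d ∈ X <;> simp [cross, ha, hb, hc, hd] at hin hout hX ⊢ <;> omega

/-- One of two pairings of the neighbours of a vertex of degree four can be split off. -/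
theorem exists_pairing {p q : E → V} {F : Finset E} {W : Finset V} {a b c d : V}
    (hin : ∀ X ⊆ W, X.Nonempty → 4 ≤ cut p q F X + (if a ∈ X then 1 else 0) +
      (if b ∈ X then 1 else 0) + (if c ∈ X then 1 else 0) + (if d ∈ X then 1 else 0))
    (hout : ∀ X ⊆ W, 4 ≤ cut p q F X + (if a ∈ X then 0 else 1) +
      (if b ∈ X then 0 else 1) + (if c ∈ X then 0 else 1) + (if d ∈ X then 0 else 1)) :
    (∀ X ⊆ W, X.Nonempty → 4 ≤ cut p q F X + cross a b X + cross c d X) ∨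
    (∀ X ⊆ W, X.Nonempty → 4 ≤ cut p q F X + cross a c X + cross b d X) := by
  by_contra! ⟨⟨X, hXW, hX, hXc⟩, Y, hYW, hY, hYc⟩
  have hX3 := separates_of_light (hin X hXW hX) (hout X hXW) hXc
  have hY3 := separates_of_light (a := a) (b := c) (c := b) (d := d)
    (by have := hin Y hYW hY; omega) (by have := hout Y hYW; omega) hYc
  have h1 := (isCutLike_cut p q F).inter_union X Y
  have h2 := (isCutLike_cut p q F).sdiff_sdiff X Y
  have h3 := even_cut p q F X Y
  have i1 := hin (X ∩ Y) (Finset.inter_subset_left.trans hXW)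
  have i2 := hin (X \ Y) (Finset.sdiff_subset.trans hXW)
  have i3 := hin (Y \ X) (Finset.sdiff_subset.trans hYW)
  have i4 := hout (X ∪ Y) (Finset.union_subset hXW hYW)
  have ne : ∀ {z : V} {Z : Finset V}, z ∈ Z → Z.Nonempty := fun h => ⟨_, h⟩
  obtain ⟨hX3, ⟨xa, xb, xc, xd⟩ | ⟨xa, xb, xc, xd⟩⟩ := hX3 <;>
    obtain ⟨hY3, ⟨ya, yc, yb, yd⟩ | ⟨ya, yc, yb, yd⟩⟩ := hY3
  · replace i1 := i1 (ne (z := a) (by simp [*]))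
    replace i2 := i2 (ne (z := b) (by simp [*]))
    replace i3 := i3 (ne (z := c) (by simp [*]))
    simp only [Finset.mem_inter, Finset.mem_sdiff, Finset.mem_union, xa, xb, xc, xd, ya, yb, yc,
      yd, not_true, not_false_iff, and_true, and_false, or_false, or_true, if_true, if_false]
      at i1 i2 i3 i4
    omega
  · replace i1 := i1 (ne (z := b) (by simp [*]))
    replace i2 := i2 (ne (z := a) (by simp [*]))
    replace i3 := i3 (ne (z := d) (by simp [*]))
    simp only [Finset.mem_inter, Finset.mem_sdiff, Finset.mem_union, xa, xb, xc, xd, ya, yb, yc,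
      yd, not_true, not_false_iff, and_true, and_false, or_false, or_true, if_true, if_false]
      at i1 i2 i3 i4
    omega
  · replace i1 := i1 (ne (z := c) (by simp [*]))
    replace i2 := i2 (ne (z := d) (by simp [*]))
    replace i3 := i3 (ne (z := a) (by simp [*]))
    simp only [Finset.mem_inter, Finset.mem_sdiff, Finset.mem_union, xa, xb, xc, xd, ya, yb, yc,
      yd, not_true, not_false_iff, and_true, and_false, or_false, or_true, if_true, if_false]
      at i1 i2 i3 i4
    omega
  · replace i1 := i1 (ne (z := d) (by simp [*]))
    replace i2 := i2 (ne (z := c) (by simp [*]))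
    replace i3 := i3 (ne (z := b) (by simp [*]))
    simp only [Finset.mem_inter, Finset.mem_sdiff, Finset.mem_union, xa, xb, xc, xd, ya, yb, yc,
      yd, not_true, not_false_iff, and_true, and_false, or_false, or_true, if_true, if_false]
      at i1 i2 i3 i4
    omega

variable [DecidableEq E]

theorem cut_erase_add {p q : E → V} {F : Finset E} {e : E} (he : e ∈ F) (X : Finset V) :
    cut p q (F.erase e) X + cross (p e) (q e) X = cut p q F X :=
  Finset.sum_erase_add F _ he

/-- If no edge can be deleted, then some vertex has degree four. -/
theorem exists_cut_singleton_eq_four {p q : E → V} {F : Finset E} {W : Finset V}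
    (hW : W.Nonempty) (h : FourCut p q F W) (hdel : ∀ e ∈ F, ¬ FourCut p q (F.erase e) W) :
    ∃ v ∈ W, cut p q F {v} = 4 := by
  have htight : ∀ e ∈ F, ∃ X ⊆ W, cut p q F X = 4 ∧ cross (p e) (q e) X = 1 := fun e he => by
    have := hdel e he
    unfold FourCut at this
    push Not at this
    obtain ⟨X, hX, hne, hlt⟩ := this
    have := h X hX hne
    have := cut_erase_add (p := p) (q := q) he X
    have := cross_le_one (p e) (q e) X
    exact ⟨X, hX, by omega, by omega⟩
  have hF : F.Nonempty := by
    rw [Finset.nonempty_iff_ne_empty]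
    rintro rfl
    have := h W subset_rfl hW
    simp [cut] at this
  obtain ⟨e₀, he₀⟩ := hF
  obtain ⟨X₀, hX₀, h₀, hc₀⟩ := htight e₀ he₀
  have hX₀ne : X₀.Nonempty := by
    rcases cross_eq_one_iff.1 hc₀ with h | h <;> exact ⟨_, h.1⟩
  obtain ⟨X, hX, hmin⟩ := Finset.exists_min_image
    (W.powerset.filter fun X => X.Nonempty ∧ cut p q F X = 4) Finset.card
    ⟨X₀, by simp [*]⟩
  simp only [Finset.mem_filter, Finset.mem_powerset, and_imp] at hX hmin
  obtain ⟨hXW, ⟨x, hx⟩, hX4⟩ := hX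
  have hint : ∀ e ∈ F, ¬ (p e ∈ X ∧ q e ∈ X) := by
    rintro e he ⟨hp, hq⟩
    obtain ⟨Y, hY, hY4, hc⟩ := htight e he
    have hne : (X ∩ Y).Nonempty := by
      rcases cross_eq_one_iff.1 hc with h | h
      · exact ⟨p e, by simp [*]⟩
      · exact ⟨q e, by simp [*]⟩
    have h1 := h _ (Finset.inter_subset_left.trans hXW) hne
    have h2 := h _ (Finset.union_subset hXW hY) ⟨x, Finset.mem_union_left _ hx⟩
    have h3 := (isCutLike_cut p q F).inter_union X Y
    have h4 := hmin _ (Finset.inter_subset_left.trans hXW) hne (by omega)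
    have h5 := Finset.eq_of_subset_of_card_le Finset.inter_subset_left h4
    have hsub : X ⊆ Y := h5 ▸ Finset.inter_subset_right
    simp [cross, hsub hp, hsub hq] at hc
  refine ⟨x, hXW hx, ?_⟩
  by_cases hXx : (X.erase x).Nonempty
  · have h1 := h {x} (by simpa using hXW hx) (Finset.singleton_nonempty x)
    have h2 := h _ ((Finset.erase_subset _ _).trans hXW) hXx
    have h3 : cut p q F {x} + cut p q F (X.erase x) ≤ cut p q F X := by
      simp only [cut, ← Finset.sum_add_distrib]
      refine Finset.sum_le_sum fun e he => ?_
      have := hint e he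
      by_cases hp : p e = x
      · have hq : q e ∉ X := fun h => this ⟨hp ▸ hx, h⟩
        have hqx : q e ≠ x := fun h => hq (h ▸ hx)
        simp [cross, hp, hx, hq, hqx]
      · by_cases hq : q e = x
        · have hp' : p e ∉ X := fun h => this ⟨h, hq ▸ hx⟩
          simp [cross, hq, hx, hp, hp']
        · simp [cross, hp, hq]
    omega
  · rw [Finset.not_nonempty_iff_eq_empty, Finset.erase_eq_empty_iff] at hXx
    rcases hXx with rfl | rfl
    · simp at hx
    · exact hX4

/-- Splitting off a vertex of degree four and reinserting it in an order. -/
theorem exists_ordered_of_split {p q : E → V} {F : Finset E} {W : Finset V} {v : V} (hv : v ∉ W)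
    {g₁ g₂ g₃ g₄ : E} (h₁₂ : g₁ ≠ g₂) (h₁₃ : g₁ ≠ g₃) (h₁₄ : g₁ ≠ g₄) (h₂₃ : g₂ ≠ g₃)
    (h₂₄ : g₂ ≠ g₄) (h₃₄ : g₃ ≠ g₄) (hg₁ : g₁ ∉ F) (hg₂ : g₂ ∉ F) (hg₃ : g₃ ∉ F) (hg₄ : g₄ ∉ F)
    (hF : ∀ e ∈ F, p e ≠ v ∧ q e ≠ v) {x : E → V} (hx : ∀ e, x e ≠ v)
    (hpq : ∀ e ∈ ({g₁, g₂, g₃, g₄} : Finset E), ∀ X, cross (p e) (q e) X = cross v (x e) X)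
    (hfour : FourCut p q (insert g₁ (insert g₂ (insert g₃ (insert g₄ F)))) (insert v W))
    (ih : ∀ p' q' : E → V, FourCut p' q' (insert g₁ (insert g₂ F)) W →
      ∃ θ τ, Ordered p' q' (insert g₁ (insert g₂ F)) W θ τ) :
    ∃ θ τ, Ordered p q (insert g₁ (insert g₂ (insert g₃ (insert g₄ F)))) (insert v W) θ τ := by
  have split : ∀ a b c d : V, a ≠ v → b ≠ v → c ≠ v → d ≠ v →
      (∀ X ⊆ W, X.Nonempty → 4 ≤ cut p q F X + cross a b X + cross c d X) →
      Extends p q F W v a b c d := by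
    intro a b c d ha hb hc hd hcut
    let p' : E → V := fun e => if e = g₁ then a else if e = g₂ then c else p e
    let q' : E → V := fun e => if e = g₁ then b else if e = g₂ then d else q e
    have hsum : ∀ (P : E → Prop) [DecidablePred P] (X : Finset V),
        (∑ e ∈ insert g₁ (insert g₂ F), if P e then cross (p' e) (q' e) X else 0) =
        (∑ e ∈ F, if P e then cross (p e) (q e) X else 0) +
          (if P g₁ then cross a b X else 0) + (if P g₂ then cross c d X else 0) := by
      intro P _ X
      rw [Finset.sum_insert (by simp [*]), Finset.sum_insert hg₂]
      have : ∀ e ∈ F, p' e = p e ∧ q' e = q e := fun e he => by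
        have h1 : e ≠ g₁ := fun h => hg₁ (h ▸ he)
        have h2 : e ≠ g₂ := fun h => hg₂ (h ▸ he)
        simp [p', q', h1, h2]
      rw [Finset.sum_congr rfl fun e he => by rw [(this e he).1, (this e he).2]]
      simp only [p', q', if_true, h₁₂.symm, if_false]
      omega
    obtain ⟨θ, τ, hord⟩ := ih p' q' fun X hX hne => by
      have h1 := hsum (fun _ => True) X
      have h2 := hcut X hX hne
      simp only [if_true] at h1
      unfold cut at h2 ⊢
      omega
    refine extends_of_admits (θ := θ) (τ := τ) (k := τ g₁) (l := τ g₂) hF ⟨ha, hb, hc, hd⟩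
      ⟨fun X hX y hy hmin => ?_, fun X hX y hy hmax => ?_⟩
    · have := (hord X hX y hy).1 hmin
      unfold early at this
      rwa [hsum] at this
    · have := (hord X hX y hy).2 hmax
      unfold late at this
      rwa [hsum] at this
  have hsum : ∀ f : E → ℕ, ∑ e ∈ insert g₁ (insert g₂ (insert g₃ (insert g₄ F))), f e =
      ∑ e ∈ F, f e + f g₁ + f g₂ + f g₃ + f g₄ := fun f => by
    rw [Finset.sum_insert (by simp [*]), Finset.sum_insert (by simp [*]),
      Finset.sum_insert (by simp [*]), Finset.sum_insert hg₄]
    ring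
  have m1 := hpq g₁ (by simp)
  have m2 := hpq g₂ (by simp)
  have m3 := hpq g₃ (by simp)
  have m4 := hpq g₄ (by simp)
  have hext : Extends p q F W v (x g₁) (x g₂) (x g₃) (x g₄) := by
    have key : (∀ X ⊆ W, X.Nonempty →
          4 ≤ cut p q F X + cross (x g₁) (x g₂) X + cross (x g₃) (x g₄) X) ∨
        (∀ X ⊆ W, X.Nonempty →
          4 ≤ cut p q F X + cross (x g₁) (x g₃) X + cross (x g₂) (x g₄) X) := by
      refine exists_pairing (fun X hX hne => ?_) (fun X hX => ?_)
      · have := hfour X (hX.trans (Finset.subset_insert _ _)) hne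
        have hvX : v ∉ X := fun h => hv (hX h)
        rw [cut, hsum, m1, m2, m3, m4] at this
        simp only [cross_of_notMem hvX] at this
        exact this
      · have := hfour (insert v X) (Finset.insert_subset_insert _ hX)
          (Finset.insert_nonempty _ _)
        have hvX : v ∉ X := fun h => hv (hX h)
        rw [cut, hsum, m1, m2, m3, m4] at this
        have hc : ∀ e ∈ F, cross (p e) (q e) (insert v X) = cross (p e) (q e) X :=
          fun e he => by simp [cross, hF e he]
        rw [Finset.sum_congr rfl hc] at this
        simp only [cross_of_mem (Finset.mem_insert_self v X), Finset.mem_insert, hx,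
          false_or] at this
        exact this
    rcases key with h | h
    · exact split _ _ _ _ (hx _) (hx _) (hx _) (hx _) h
    · exact (split _ _ _ _ (hx _) (hx _) (hx _) (hx _) h).swap_middle
  obtain ⟨θ, τ, k₁, k₂, k₃, k₄, h⟩ := hext
  let τ' : E → ℤ := fun e => if e = g₁ then k₁ else if e = g₂ then k₂ else if e = g₃ then k₃
    else if e = g₄ then k₄ else τ e
  have t1 : τ' g₁ = k₁ := by simp [τ']
  have t2 : τ' g₂ = k₂ := by simp [τ', h₁₂.symm]
  have t3 : τ' g₃ = k₃ := by simp [τ', h₁₃.symm, h₂₃.symm]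
  have t4 : τ' g₄ = k₄ := by simp [τ', h₁₄.symm, h₂₄.symm, h₃₄.symm]
  have tF : ∀ e ∈ F, τ' e = τ e := fun e he => by
    have h1 : e ≠ g₁ := fun h => hg₁ (h ▸ he)
    have h2 : e ≠ g₂ := fun h => hg₂ (h ▸ he)
    have h3 : e ≠ g₃ := fun h => hg₃ (h ▸ he)
    have h4 : e ≠ g₄ := fun h => hg₄ (h ▸ he)
    simp [τ', h1, h2, h3, h4]
  refine ⟨θ, τ', fun X hX y hy => ⟨fun hmin => ?_, fun hmax => ?_⟩⟩
  · have := (h X hX y hy).1 hmin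
    rw [early, hsum, t1, t2, t3, t4, m1, m2, m3, m4,
      Finset.sum_congr rfl fun e he => by rw [tF e he]]
    exact this
  · have := (h X hX y hy).2 hmax
    rw [late, hsum, t1, t2, t3, t4, m1, m2, m3, m4,
      Finset.sum_congr rfl fun e he => by rw [tF e he]]
    exact this

theorem exists_ordered (n : ℕ) : ∀ (p q : E → V) (F : Finset E) (W : Finset V), F.card ≤ n →
    FourCut p q F W → ∃ θ τ, Ordered p q F W θ τ := by
  induction n with
  | zero =>
    intro p q F W hn h
    refine ⟨0, 0, fun X hX x hx => ?_⟩
    have := h X hX ⟨x, hx⟩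
    rw [Finset.card_eq_zero.1 (Nat.le_zero.1 hn)] at this
    simp [cut] at this
  | succ n ih =>
    intro p q F W hn h
    by_cases hdel : ∃ e ∈ F, FourCut p q (F.erase e) W
    · obtain ⟨e, he, hcut⟩ := hdel
      have := Finset.card_erase_add_one he
      obtain ⟨θ, τ, ho⟩ := ih p q _ W (by omega) hcut
      exact ⟨θ, τ, ho.mono (Finset.erase_subset _ _)⟩
    push Not at hdel
    rcases W.eq_empty_or_nonempty with rfl | hW
    · exact ⟨0, 0, fun X hX x hx => absurd (hX hx) (Finset.notMem_empty x)⟩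
    obtain ⟨v, hvW, hv4⟩ := exists_cut_singleton_eq_four hW h hdel
    have hloop : ∀ e ∈ F, p e ≠ q e := fun e he hpq => hdel e he fun X hX hne => by
      have := h X hX hne
      have := cut_erase_add (p := p) (q := q) he X
      have : cross (p e) (q e) X = 0 := by simp [cross, hpq]
      omega
    have hcard : (F.filter fun e => p e = v ∨ q e = v).card = 4 := by
      rw [← hv4, cut, Finset.card_filter]
      refine Finset.sum_congr rfl fun e he => ?_
      have := hloop e he
      by_cases hp : p e = v
      · simp [cross, hp, show q e ≠ v from fun h => this (hp.trans h.symm)]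
      · by_cases hq : q e = v <;> simp [cross, hp, hq]
    obtain ⟨g₁, S, hg₁, hS, hS3⟩ := Finset.card_eq_succ.1 hcard
    obtain ⟨g₂, g₃, g₄, h₂₃, h₂₄, h₃₄, rfl⟩ := Finset.card_eq_three.1 hS3
    simp only [Finset.mem_insert, Finset.mem_singleton, not_or] at hg₁
    obtain ⟨h₁₂, h₁₃, h₁₄⟩ := hg₁
    set F₀ := F.filter fun e => ¬ (p e = v ∨ q e = v) with hF₀
    have hinc : ∀ e ∈ ({g₁, g₂, g₃, g₄} : Finset E), e ∈ F ∧ (p e = v ∨ q e = v) := fun e he => by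
      rw [hS] at he
      exact Finset.mem_filter.1 he
    have hnot : ∀ e ∈ ({g₁, g₂, g₃, g₄} : Finset E), e ∉ F₀ := fun e he h =>
      (Finset.mem_filter.1 h).2 (hinc e he).2
    have n1 := hnot g₁ (by simp)
    have n2 := hnot g₂ (by simp)
    have n3 := hnot g₃ (by simp)
    have n4 := hnot g₄ (by simp)
    have hFeq : F = insert g₁ (insert g₂ (insert g₃ (insert g₄ F₀))) := by
      have := Finset.filter_union_filter_not_eq (fun e => p e = v ∨ q e = v) F
      rw [← hS] at this
      rw [← this]
      simp only [Finset.insert_union, Finset.singleton_union]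
      rfl
    have hcardF : (insert g₁ (insert g₂ F₀)).card ≤ n := by
      rw [hFeq, Finset.card_insert_of_notMem (by simp [h₁₂, h₁₃, h₁₄, n1]),
        Finset.card_insert_of_notMem (by simp [h₂₃, h₂₄, n2]),
        Finset.card_insert_of_notMem (by simp [h₃₄, n3]),
        Finset.card_insert_of_notMem n4] at hn
      have h1 := Finset.card_insert_le g₁ (insert g₂ F₀)
      have h2 := Finset.card_insert_le g₂ F₀
      omega
    have hWv : W = insert v (W.erase v) := (Finset.insert_erase hvW).symm
    obtain ⟨u, hu⟩ : ∃ u, u ≠ v := by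
      have := hinc g₁ (by simp)
      by_contra! hall
      exact hloop g₁ this.1 ((hall _).trans (hall _).symm)
    rw [hFeq, hWv] at h ⊢
    refine exists_ordered_of_split (Finset.notMem_erase v W) h₁₂ h₁₃ h₁₄ h₂₃ h₂₄ h₃₄
      n1 n2 n3 n4
      (fun e he => by simpa [not_or] using (Finset.mem_filter.1 he).2)
      (x := fun e => if p e ≠ v then p e else if q e ≠ v then q e else u) (fun e => ?_)
      (fun e he X => ?_) h fun p' q' h' => ih p' q' _ _ hcardF h'
    · split_ifs <;> assumption
    · have h1 := hinc e he
      have h2 := hloop e h1.1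
      by_cases hp : p e = v
      · have hq : q e ≠ v := fun h => h2 (hp.trans h.symm)
        simp [hp, hq]
      · have hq : q e = v := h1.2.resolve_left hp
        simp [hp, hq, cross, iff_comm]

end EdgeOrder

namespace EdgeOrder

variable {V E : Type}

/-! ### Numbering the edges along ears -/

/-- The edge `e` joins `a` and `b`. -/
def Joins (p q : E → V) (e : E) (a b : V) : Prop := (p e = a ∧ q e = b) ∨ (p e = b ∧ q e = a)

theorem Joins.symm {p q : E → V} {e : E} {a b : V} (h : Joins p q e a b) : Joins p q e b a :=
  Or.symm h

theorem Joins.eq_or_eq {p q : E → V} {e : E} {a b c d : V} (h : Joins p q e a b)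
    (h' : Joins p q e c d) : (a = c ∧ b = d) ∨ (a = d ∧ b = c) := by
  unfold Joins at h h'
  rcases h with ⟨rfl, rfl⟩ | ⟨rfl, rfl⟩ <;> tauto

/-- There is a walk of length `n` from `y` to `B` whose edges satisfy `P`. -/
def Hits (p q : E → V) (P : E → Prop) (B : V → Prop) : ℕ → V → Prop
  | 0, y => B y
  | n + 1, y => ∃ e z, P e ∧ Joins p q e y z ∧ Hits p q P B n z

theorem exists_path_of_hits [Nonempty E] {p q : E → V} {P : E → Prop} {B : V → Prop} {n : ℕ}
    {y : V} (h : Hits p q P B n y) : ∃ (k : ℕ) (x : ℕ → V) (ed : ℕ → E), x 0 = y ∧ B (x k) ∧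
      (∀ i < k, ¬ B (x i)) ∧ (∀ i ≤ k, ∀ j ≤ k, x i = x j → i = j) ∧
      ∀ i < k, P (ed i) ∧ Joins p q (ed i) (x i) (x (i + 1)) := by
  classical
  have : Nonempty V := ⟨y⟩
  let good : V → Prop := fun y => ∃ n, Hits p q P B n y
  let D : V → ℕ := fun y => if hy : good y then Nat.find hy else 0
  have hDle : ∀ {n y}, Hits p q P B n y → D y ≤ n := fun {n y} h => by
    have hy : good y := ⟨n, h⟩
    simp only [D, dif_pos hy]
    exact Nat.find_min' hy h
  have hDspec : ∀ y, good y → Hits p q P B (D y) y := fun y hy => by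
    simp only [D, dif_pos hy]
    exact Nat.find_spec hy
  have hstep : ∀ y, good y ∧ D y ≠ 0 → ∃ e z, P e ∧ Joins p q e y z ∧ good z ∧ D z + 1 = D y := by
    rintro y ⟨hy, h0⟩
    obtain ⟨m, hm⟩ := Nat.exists_eq_succ_of_ne_zero h0
    have := hDspec y hy
    rw [hm] at this
    obtain ⟨e, z, he, hj, hz⟩ := this
    refine ⟨e, z, he, hj, ⟨m, hz⟩, ?_⟩
    have h1 := hDle hz
    have h2 : D y ≤ D z + 1 := hDle (n := D z + 1) ⟨e, z, he, hj, hDspec z ⟨m, hz⟩⟩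
    omega
  choose! nexte next hP hJ hgood hD using hstep
  have hx : ∀ i ≤ D y, good (next^[i] y) ∧ D (next^[i] y) + i = D y := fun i => by
    induction i with
    | zero => exact fun _ => ⟨⟨n, h⟩, rfl⟩
    | succ i ih =>
      intro hi
      obtain ⟨h1, h2⟩ := ih (by omega)
      rw [Function.iterate_succ_apply']
      have h3 : D (next^[i] y) ≠ 0 := by omega
      have := hD _ ⟨h1, h3⟩
      exact ⟨hgood _ ⟨h1, h3⟩, by omega⟩
  refine ⟨D y, fun i => next^[i] y, fun i => nexte (next^[i] y), rfl, ?_, fun i hi hB => ?_,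
    fun i hi j hj hij => ?_, fun i hi => ?_⟩
  · obtain ⟨h1, h2⟩ := hx _ le_rfl
    have := hDspec _ h1
    rwa [show D (next^[D y] y) = 0 by omega] at this
  · have h0 : D (next^[i] y) ≤ 0 := hDle (n := 0) hB
    have := (hx i hi.le).2
    omega
  · have h1 := (hx i hi).2
    have h2 := (hx j hj).2
    simp only at hij
    rw [hij] at h1
    omega
  · obtain ⟨h1, h2⟩ := hx i hi.le
    have h3 : D (next^[i] y) ≠ 0 := by omega
    simp only [Function.iterate_succ_apply']
    exact ⟨hP _ ⟨h1, h3⟩, hJ _ ⟨h1, h3⟩⟩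

/-- The vertices of `A` have two parent edges `π₁, π₂` leading to `n₁, n₂` in `A ∪ {r}`, such that
the labels `f` decrease towards `r` along the first and increase along the second, and both
parent edges precede the vertex. -/
structure Numbering (p q : E → V) (r : V) (θ : V → ℤ) (τ : E → ℤ) (A : Finset V)
    (π₁ π₂ : V → E) (n₁ n₂ : V → V) (f : E → ℚ) (s : V → ℤ) : Prop where
  joins₁ : ∀ v ∈ A, Joins p q (π₁ v) v (n₁ v)
  joins₂ : ∀ v ∈ A, Joins p q (π₂ v) v (n₂ v)
  mem₁ : ∀ v ∈ A, n₁ v = r ∨ n₁ v ∈ A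
  mem₂ : ∀ v ∈ A, n₂ v = r ∨ n₂ v ∈ A
  time₁ : ∀ v ∈ A, τ (π₁ v) ≤ s v
  time₂ : ∀ v ∈ A, τ (π₂ v) ≤ s v
  mono₁ : ∀ v ∈ A, n₁ v ∈ A → s (n₁ v) ≤ s v
  mono₂ : ∀ v ∈ A, n₂ v ∈ A → s (n₂ v) ≤ s v
  lt : ∀ v ∈ A, f (π₁ v) < f (π₂ v)
  lt₁ : ∀ v ∈ A, n₁ v ∈ A → f (π₁ (n₁ v)) < f (π₁ v)
  lt₂ : ∀ v ∈ A, n₂ v ∈ A → f (π₂ v) < f (π₂ (n₂ v))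
  le : ∀ v ∈ A, s v ≤ θ v
  later : ∀ v ∈ A, ∀ u ∉ A, u ≠ r → s v ≤ θ u

/-- A path or cycle of length `k` with ends in `B`, whose interior avoids `B`. -/
structure Ear (p q : E → V) (P : E → Prop) (B : V → Prop) (k : ℕ) (x : ℕ → V) (ed : ℕ → E) :
    Prop where
  two_le : 2 ≤ k
  start : B (x 0)
  finish : B (x k)
  interior : ∀ i, 0 < i → i < k → ¬ B (x i)
  inj : ∀ i j, 0 < i → i < k → 0 < j → j < k → x i = x j → i = j
  edge_inj : ∀ i j, i < k → j < k → ed i = ed j → i = j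
  prop : ∀ i < k, P (ed i)
  joins : ∀ i < k, Joins p q (ed i) (x i) (x (i + 1))

theorem Ear.reverse {p q : E → V} {P : E → Prop} {B : V → Prop} {k : ℕ} {x : ℕ → V}
    {ed : ℕ → E} (h : Ear p q P B k x ed) :
    Ear p q P B k (fun i => x (k - i)) (fun i => ed (k - 1 - i)) where
  two_le := h.two_le
  start := h.finish
  finish := by simpa using h.start
  interior i h0 hi := h.interior _ (by omega) (by omega)
  inj i j h0 hi h0' hj hij := by
    have := h.inj _ _ (by omega) (by omega) (by omega) (by omega) hij
    omega
  edge_inj i j hi hj hij := by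
    have := h.edge_inj _ _ (by omega) (by omega) hij
    omega
  prop i hi := h.prop _ (by omega)
  joins i hi := by
    have := (h.joins (k - 1 - i) (by omega)).symm
    rwa [show k - 1 - i + 1 = k - i by omega, show k - 1 - i = k - (i + 1) by omega] at *

theorem Numbering.extend [DecidableEq V] {p q : E → V} {r : V} {θ : V → ℤ} {τ : E → ℤ}
    {A : Finset V} {π₁ π₂ : V → E} {n₁ n₂ : V → V} {f : E → ℚ} {s : V → ℤ}
    (h : Numbering p q r θ τ A π₁ π₂ n₁ n₂ f s) {m : ℤ}
    (hm : ∀ u ∉ A, u ≠ r → m ≤ θ u) (hsm : ∀ v ∈ A, s v ≤ m) {k : ℕ} {x : ℕ → V} {ed : ℕ → E}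
    (hear : Ear p q (fun e => τ e ≤ m) (fun v => v = r ∨ v ∈ A) k x ed)
    (hlt : x 0 ∈ A → x k ∈ A → f (π₁ (x 0)) < f (π₂ (x k))) :
    ∃ A' : Finset V, A ⊂ A' ∧ (r ∉ A → r ∉ A') ∧
      ∃ π₁ π₂ n₁ n₂ f s, Numbering p q r θ τ A' π₁ π₂ n₁ n₂ f s := by
  classical
  have h2 := hear.two_le
  have hintA : ∀ j, j + 1 < k → x (j + 1) ∉ A := fun j hj hA =>
    hear.interior (j + 1) (by omega) hj (Or.inr hA)
  have hintr : ∀ j, j + 1 < k → x (j + 1) ≠ r := fun j hj hr =>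
    hear.interior (j + 1) (by omega) hj (Or.inl hr)
  obtain ⟨L, U, hLU, hL, hU⟩ : ∃ L U : ℚ, L < U ∧ (x 0 ∈ A → f (π₁ (x 0)) ≤ L) ∧
      (x k ∈ A → U ≤ f (π₂ (x k))) := by
    by_cases h0 : x 0 ∈ A
    · by_cases hk : x k ∈ A
      · exact ⟨_, _, hlt h0 hk, fun _ => le_rfl, fun _ => le_rfl⟩
      · exact ⟨_, _, lt_add_one (f (π₁ (x 0))), fun _ => le_rfl, fun h => absurd h hk⟩
    · exact ⟨_, _, sub_one_lt (f (π₂ (x k))), fun h => absurd h h0, fun _ => le_rfl⟩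
  let val : ℕ → ℚ := fun i => L + (i + 1) / (k + 1) * (U - L)
  have hval : ∀ i, val i < val (i + 1) := fun i => by
    have : (0 : ℚ) < U - L := sub_pos.2 hLU
    simp only [val]
    push_cast
    gcongr
    linarith
  have hval0 : L < val 0 := by
    have : (0 : ℚ) < U - L := sub_pos.2 hLU
    simp only [val, lt_add_iff_pos_right]
    positivity
  have hvalk : ∀ i, i < k → val i < U := fun i hi => by
    have h3 : (0 : ℚ) < U - L := sub_pos.2 hLU
    have h4 : ((i : ℚ) + 1) / (k + 1) < 1 := by
      rw [div_lt_one (by positivity)]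
      exact_mod_cast Nat.succ_lt_succ hi
    have := mul_lt_mul_of_pos_right h4 h3
    simp only [val]
    linarith
  let idx : V → ℕ := fun v => if hv : ∃ j, j + 1 < k ∧ x (j + 1) = v then hv.choose else 0
  let jdx : E → ℕ := fun e => if he : ∃ i, i < k ∧ ed i = e then he.choose else 0
  have hidx : ∀ j, j + 1 < k → idx (x (j + 1)) = j := fun j hj => by
    have hv : ∃ i, i + 1 < k ∧ x (i + 1) = x (j + 1) := ⟨j, hj, rfl⟩
    simp only [idx, dif_pos hv]
    have := hear.inj _ _ (by omega) hv.choose_spec.1 (by omega) hj hv.choose_spec.2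
    omega
  let g : E → ℚ := fun e => if ∃ i, i < k ∧ ed i = e then val (jdx e) else f e
  have hg : ∀ i, i < k → g (ed i) = val i := fun i hi => by
    have he : ∃ j, j < k ∧ ed j = ed i := ⟨i, hi, rfl⟩
    simp only [g, jdx, if_pos he, dif_pos he]
    rw [hear.edge_inj _ _ he.choose_spec.1 hi he.choose_spec.2]
  have hgA : ∀ e a b, Joins p q e a b → (a = r ∨ a ∈ A) → (b = r ∨ b ∈ A) → g e = f e := by
    intro e a b hj ha hb
    refine if_neg ?_
    rintro ⟨i, hi, rfl⟩
    rcases Nat.eq_zero_or_pos i with rfl | h0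
    · rcases hj.eq_or_eq (hear.joins 0 hi) with ⟨rfl, rfl⟩ | ⟨rfl, rfl⟩
      · exact hear.interior 1 (by omega) (by omega) hb
      · exact hear.interior 1 (by omega) (by omega) ha
    · rcases hj.eq_or_eq (hear.joins i hi) with ⟨rfl, rfl⟩ | ⟨rfl, rfl⟩
      · exact hear.interior i h0 hi ha
      · exact hear.interior i h0 hi hb
  have hg₁ : ∀ v ∈ A, g (π₁ v) = f (π₁ v) := fun v hv =>
    hgA _ _ _ (h.joins₁ v hv) (Or.inr hv) (h.mem₁ v hv)
  have hg₂ : ∀ v ∈ A, g (π₂ v) = f (π₂ v) := fun v hv =>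
    hgA _ _ _ (h.joins₂ v hv) (Or.inr hv) (h.mem₂ v hv)
  let A' : Finset V := A ∪ (Finset.range (k - 1)).image fun j => x (j + 1)
  have hA' : ∀ v, v ∈ A' ↔ v ∈ A ∨ ∃ j, j + 1 < k ∧ x (j + 1) = v := fun v => by
    simp only [A', Finset.mem_union, Finset.mem_image, Finset.mem_range]
    simp only [show ∀ j, j < k - 1 ↔ j + 1 < k by omega]
  let ρ₁ : V → E := fun v => if v ∈ A then π₁ v else ed (idx v)
  let ρ₂ : V → E := fun v => if v ∈ A then π₂ v else ed (idx v + 1)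
  let o₁ : V → V := fun v => if v ∈ A then n₁ v else x (idx v)
  let o₂ : V → V := fun v => if v ∈ A then n₂ v else x (idx v + 2)
  let t : V → ℤ := fun v => if v ∈ A then s v else m
  have hρ₁ : ∀ v ∈ A, ρ₁ v = π₁ v := fun v hv => if_pos hv
  have hρ₂ : ∀ v ∈ A, ρ₂ v = π₂ v := fun v hv => if_pos hv
  have ho₁ : ∀ v ∈ A, o₁ v = n₁ v := fun v hv => if_pos hv
  have ho₂ : ∀ v ∈ A, o₂ v = n₂ v := fun v hv => if_pos hv
  have ht : ∀ v ∈ A, t v = s v := fun v hv => if_pos hv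
  have hρ₁' : ∀ j, j + 1 < k → ρ₁ (x (j + 1)) = ed j := fun j hj => by
    simp only [ρ₁, if_neg (hintA j hj), hidx j hj]
  have hρ₂' : ∀ j, j + 1 < k → ρ₂ (x (j + 1)) = ed (j + 1) := fun j hj => by
    simp only [ρ₂, if_neg (hintA j hj), hidx j hj]
  have ho₁' : ∀ j, j + 1 < k → o₁ (x (j + 1)) = x j := fun j hj => by
    simp only [o₁, if_neg (hintA j hj), hidx j hj]
  have ho₂' : ∀ j, j + 1 < k → o₂ (x (j + 1)) = x (j + 2) := fun j hj => by
    simp only [o₂, if_neg (hintA j hj), hidx j hj]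
  have ht' : ∀ j, j + 1 < k → t (x (j + 1)) = m := fun j hj => by
    simp only [t, if_neg (hintA j hj)]
  have htm : ∀ v, t v ≤ m := fun v => by
    by_cases hv : v ∈ A
    · exact (ht v hv).le.trans (hsm v hv)
    · exact (if_neg hv).le
  have hxB : ∀ j ≤ k, x j = r ∨ x j ∈ A' := fun j hj => by
    rcases Nat.eq_zero_or_pos j with rfl | h0
    · exact hear.start.imp_right fun h => (hA' _).2 (Or.inl h)
    · rcases hj.eq_or_lt with rfl | hj
      · exact hear.finish.imp_right fun h => (hA' _).2 (Or.inl h)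
      · obtain ⟨i, rfl⟩ := Nat.exists_eq_succ_of_ne_zero h0.ne'
        exact Or.inr ((hA' _).2 (Or.inr ⟨i, hj, rfl⟩))
  have hback : ∀ w, (w = r ∨ w ∈ A) → w ∈ A' → w ∈ A := fun w hw hw' => by
    rcases (hA' w).1 hw' with h | ⟨j, hj, rfl⟩
    · exact h
    · exact absurd hw (hear.interior (j + 1) (by omega) hj)
  refine ⟨A', ⟨fun v hv => (hA' v).2 (Or.inl hv), fun hsub => ?_⟩, fun hr hr' => ?_,
    ρ₁, ρ₂, o₁, o₂, g, t, ?_⟩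
  · exact hintA 0 (by omega) (hsub ((hA' _).2 (Or.inr ⟨0, by omega, rfl⟩)))
  · exact hr (hback r (Or.inl rfl) hr')
  constructor <;> simp only [hA']
  · rintro v (hv | ⟨j, hj, rfl⟩)
    · rw [hρ₁ v hv, ho₁ v hv]
      exact h.joins₁ v hv
    · rw [hρ₁' j hj, ho₁' j hj]
      exact (hear.joins j (by omega)).symm
  · rintro v (hv | ⟨j, hj, rfl⟩)
    · rw [hρ₂ v hv, ho₂ v hv]
      exact h.joins₂ v hv
    · rw [hρ₂' j hj, ho₂' j hj]
      exact hear.joins (j + 1) (by omega)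
  · rintro v (hv | ⟨j, hj, rfl⟩)
    · rw [ho₁ v hv]
      exact (h.mem₁ v hv).imp_right Or.inl
    · rw [ho₁' j hj, ← hA']
      exact hxB j (by omega)
  · rintro v (hv | ⟨j, hj, rfl⟩)
    · rw [ho₂ v hv]
      exact (h.mem₂ v hv).imp_right Or.inl
    · rw [ho₂' j hj, ← hA']
      exact hxB (j + 2) (by omega)
  · rintro v (hv | ⟨j, hj, rfl⟩)
    · rw [hρ₁ v hv, ht v hv]
      exact h.time₁ v hv
    · rw [hρ₁' j hj, ht' j hj]
      exact hear.prop j (by omega)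
  · rintro v (hv | ⟨j, hj, rfl⟩)
    · rw [hρ₂ v hv, ht v hv]
      exact h.time₂ v hv
    · rw [hρ₂' j hj, ht' j hj]
      exact hear.prop (j + 1) (by omega)
  · rintro v (hv | ⟨j, hj, rfl⟩) hn
    · rw [ho₁ v hv] at hn ⊢
      have hn := hback _ (h.mem₁ v hv) ((hA' _).2 hn)
      rw [ht v hv, ht _ hn]
      exact h.mono₁ v hv hn
    · rw [ht' j hj]
      exact htm _
  · rintro v (hv | ⟨j, hj, rfl⟩) hn
    · rw [ho₂ v hv] at hn ⊢
      have hn := hback _ (h.mem₂ v hv) ((hA' _).2 hn)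
      rw [ht v hv, ht _ hn]
      exact h.mono₂ v hv hn
    · rw [ht' j hj]
      exact htm _
  · rintro v (hv | ⟨j, hj, rfl⟩)
    · rw [hρ₁ v hv, hρ₂ v hv, hg₁ v hv, hg₂ v hv]
      exact h.lt v hv
    · rw [hρ₁' j hj, hρ₂' j hj, hg _ (by omega), hg _ hj]
      exact hval j
  · rintro v (hv | ⟨j, hj, rfl⟩) hn
    · rw [ho₁ v hv] at hn ⊢
      have hn := hback _ (h.mem₁ v hv) ((hA' _).2 hn)
      rw [hρ₁ v hv, hρ₁ _ hn, hg₁ v hv, hg₁ _ hn]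
      exact h.lt₁ v hv hn
    · rw [hρ₁' j hj, ho₁' j hj, hg _ (by omega)]
      rcases j with _ | j
      · have hn : x 0 ∈ A := hback _ hear.start (by rw [← hA', ho₁' 0 hj] at hn; exact hn)
        rw [hρ₁ _ hn, hg₁ _ hn]
        exact (hL hn).trans_lt hval0
      · rw [hρ₁' j (by omega), hg _ (by omega)]
        exact hval j
  · rintro v (hv | ⟨j, hj, rfl⟩) hn
    · rw [ho₂ v hv] at hn ⊢
      have hn := hback _ (h.mem₂ v hv) ((hA' _).2 hn)
      rw [hρ₂ v hv, hρ₂ _ hn, hg₂ v hv, hg₂ _ hn]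
      exact h.lt₂ v hv hn
    · rw [← hA', ho₂' j hj] at hn
      rw [hρ₂' j hj, ho₂' j hj, hg _ hj]
      by_cases hjk : j + 2 < k
      · rw [hρ₂' (j + 1) hjk, hg _ hjk]
        exact hval (j + 1)
      · obtain rfl : k = j + 2 := by omega
        have hn : x (j + 2) ∈ A := hback _ hear.finish hn
        rw [hρ₂ _ hn, hg₂ _ hn]
        exact (hvalk _ hj).trans_le (hU hn)
  · rintro v (hv | ⟨j, hj, rfl⟩)
    · rw [ht v hv]
      exact h.le v hv
    · rw [ht' j hj]
      exact hm _ (hintA j hj) (hintr j hj)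
  · rintro v - u hu hur
    exact (htm v).trans (hm u (fun h => hu (Or.inl h)) hur)

end EdgeOrder

namespace EdgeOrder

variable {V E : Type}

theorem exists_attachment {p q : E → V} {P : E → Prop} {B : V → Prop} : ∀ (n : ℕ) (y : V),
    Hits p q P B n y →
    (∀ e a b, Joins p q e a b → B b → ∃ k, Hits p q (fun e' => P e' ∧ e' ≠ e) B k y) → ¬ B y →
    ∃ e a b, P e ∧ Joins p q e a b ∧ B a ∧ ¬ B b ∧
      ∃ k, Hits p q (fun e' => P e' ∧ e' ≠ e) B k b
  | 0, _, h, _, hy => absurd h hy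
  | n + 1, y, ⟨e, z, he, hj, hz⟩, hgood, hy => by
    by_cases hB : B z
    · exact ⟨e, z, y, he, hj.symm, hB, hy, hgood e y z hj hB⟩
    · refine exists_attachment n z hz (fun e' a b hj' hb => ?_) hB
      obtain ⟨k, hk⟩ := hgood e' a b hj' hb
      refine ⟨k + 1, e, y, ⟨he, ?_⟩, hj.symm, hk⟩
      rintro rfl
      rcases hj'.eq_or_eq hj with ⟨rfl, rfl⟩ | ⟨rfl, rfl⟩
      · exact hB hb
      · exact hy hb

theorem exists_ear [Nonempty E] {p q : E → V} {P : E → Prop} {B : V → Prop} {w : V} (hw : ¬ B w)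
    (hgood : ∀ e, ∃ n, Hits p q (fun e' => P e' ∧ e' ≠ e) B n w) :
    ∃ k x ed, Ear p q P B k x ed := by
  have hmono : ∀ (Q : E → Prop) (n : ℕ) (y : V), Hits p q (fun e => P e ∧ Q e) B n y →
      Hits p q P B n y := fun Q n => by
    induction n with
    | zero => exact fun _ h => h
    | succ n ih => exact fun y ⟨e, z, he, hj, hz⟩ => ⟨e, z, he.1, hj, ih z hz⟩
  obtain ⟨n, hn⟩ := hgood (Classical.arbitrary E)
  obtain ⟨e, a, b, he, hj, ha, hb, m, hm⟩ :=
    exists_attachment n w (hmono _ n w hn) (fun e _ _ _ _ => hgood e) hw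
  obtain ⟨k, x, ed, rfl, hk, hint, hinj, hed⟩ := exists_path_of_hits hm
  have hk0 : 0 < k := Nat.pos_of_ne_zero fun h => hb (h ▸ hk)
  refine ⟨k + 1, fun i => if i = 0 then a else x (i - 1), fun i => if i = 0 then e else ed (i - 1),
    ⟨by omega, by simpa, by simpa, fun i h0 hi => ?_, fun i j h0 hi h0' hj' hij => ?_,
      fun i j hi hj' hij => ?_, fun i hi => ?_, fun i hi => ?_⟩⟩
  · simpa [h0.ne'] using hint (i - 1) (by omega)
  · simp only [h0.ne', h0'.ne', if_false] at hij
    have := hinj _ (by omega) _ (by omega) hij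
    omega
  · rcases i with _ | i <;> rcases j with _ | j
    · rfl
    · simp only [if_true, Nat.succ_ne_zero, if_false, Nat.add_sub_cancel] at hij
      exact absurd hij.symm (hed j (by omega)).1.2
    · simp only [if_true, Nat.succ_ne_zero, if_false, Nat.add_sub_cancel] at hij
      exact absurd hij (hed i (by omega)).1.2
    · simp only [Nat.succ_ne_zero, if_false, Nat.add_sub_cancel] at hij
      have h1 := (hed i (by omega)).2
      rw [hij] at h1
      rcases h1.eq_or_eq (hed j (by omega)).2 with ⟨h2, -⟩ | ⟨h2, h3⟩
      · rw [hinj _ (by omega) _ (by omega) h2]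
      · have := hinj _ (by omega) _ (by omega) h2
        have := hinj _ (by omega) _ (by omega) h3
        omega
  · rcases i with _ | i
    · simpa
    · simpa using (hed i (by omega)).1.1
  · rcases i with _ | i
    · simpa
    · simpa using (hed i (by omega)).2

/-- Every set of vertices avoiding `r` has at least two early boundary edges at its first
vertex. -/
def EarlyRich [Fintype E] [DecidableEq V] (p q : E → V) (r : V) (θ : V → ℤ) (τ : E → ℤ) : Prop :=
  ∀ X : Finset V, r ∉ X → ∀ x ∈ X, (∀ y ∈ X, θ x ≤ θ y) → 2 ≤ early p q Finset.univ τ (θ x) X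

theorem EarlyRich.exists_hits [Fintype V] [Fintype E] [DecidableEq V] {p q : E → V} {r : V}
    {θ : V → ℤ} {τ : E → ℤ} (h : EarlyRich p q r θ τ) {A : Finset V} {w : V}
    (hw : ∀ u ∉ A, u ≠ r → θ w ≤ θ u) (e : E) :
    ∃ n, Hits p q (fun e' => τ e' ≤ θ w ∧ e' ≠ e) (fun v => v = r ∨ v ∈ A) n w := by
  classical
  by_contra hbad
  let X : Finset V := Finset.univ.filter fun y =>
    ¬ ∃ n, Hits p q (fun e' => τ e' ≤ θ w ∧ e' ≠ e) (fun v => v = r ∨ v ∈ A) n y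
  have hX : ∀ y, y ∈ X ↔
      ¬ ∃ n, Hits p q (fun e' => τ e' ≤ θ w ∧ e' ≠ e) (fun v => v = r ∨ v ∈ A) n y := by
    simp [X]
  have h2 := h X (fun hr => (hX r).1 hr ⟨0, Or.inl rfl⟩) w ((hX w).2 hbad) fun y hy =>
    hw y (fun hA => (hX y).1 hy ⟨0, Or.inr hA⟩) fun hr => (hX y).1 hy ⟨0, Or.inl hr⟩
  have h3 : early p q Finset.univ τ (θ w) X = if τ e ≤ θ w then cross (p e) (q e) X else 0 := by
    refine Finset.sum_eq_single e (fun e' _ hne => ?_) fun he => absurd (Finset.mem_univ e) he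
    by_cases hτ : τ e' ≤ θ w
    · rw [if_pos hτ]
      refine if_pos ?_
      rw [hX, hX, not_iff_not]
      exact ⟨fun ⟨n, hn⟩ => ⟨n + 1, e', _, ⟨hτ, hne⟩, Or.inr ⟨rfl, rfl⟩, hn⟩,
        fun ⟨n, hn⟩ => ⟨n + 1, e', _, ⟨hτ, hne⟩, Or.inl ⟨rfl, rfl⟩, hn⟩⟩
    · rw [if_neg hτ]
  have h4 : cross (p e) (q e) X ≤ 1 := by
    unfold cross
    split_ifs <;> simp
  rw [h3] at h2
  split_ifs at h2 <;> omega

theorem EarlyRich.exists_numbering [Fintype V] [Fintype E] [DecidableEq V] [Nonempty E]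
    {p q : E → V} {r : V} {θ : V → ℤ} {τ : E → ℤ} (h : EarlyRich p q r θ τ) :
    ∃ π₁ π₂ n₁ n₂ f s, Numbering p q r θ τ (Finset.univ.erase r) π₁ π₂ n₁ n₂ f s := by
  suffices ∀ (n : ℕ) (A : Finset V), r ∉ A → (Finset.univ \ A).card ≤ n →
      (∃ π₁ π₂ n₁ n₂ f s, Numbering p q r θ τ A π₁ π₂ n₁ n₂ f s) →
      ∃ π₁ π₂ n₁ n₂ f s, Numbering p q r θ τ (Finset.univ.erase r) π₁ π₂ n₁ n₂ f s by
    refine this _ ∅ (by simp) le_rfl ⟨fun _ => Classical.arbitrary E,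
      fun _ => Classical.arbitrary E, id, id, fun _ => 0, fun _ => 0, ?_⟩
    constructor <;> simp
  intro n
  induction n with
  | zero =>
    intro A hr hA
    have := Finset.card_pos.2 ⟨r, Finset.mem_sdiff.2 ⟨Finset.mem_univ r, hr⟩⟩
    omega
  | succ n ih =>
    rintro A hr hA ⟨π₁, π₂, n₁, n₂, f, s, hnum⟩
    rcases Finset.eq_empty_or_nonempty (Finset.univ.erase r \ A) with hemp | hne
    · have : Finset.univ.erase r = A := by
        refine le_antisymm (Finset.sdiff_eq_empty_iff_subset.1 hemp) fun v hv => ?_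
        simp only [Finset.mem_erase, Finset.mem_univ, and_true]
        rintro rfl
        exact hr hv
      rw [this]
      exact ⟨_, _, _, _, _, _, hnum⟩
    · obtain ⟨w, hw, hmin⟩ := Finset.exists_min_image _ θ hne
      simp only [Finset.mem_sdiff, Finset.mem_erase, Finset.mem_univ, and_true] at hw hmin
      have hm : ∀ u ∉ A, u ≠ r → θ w ≤ θ u := fun u hu hur => hmin u ⟨hur, hu⟩
      have hsm : ∀ v ∈ A, s v ≤ θ w := fun v hv => hnum.later v hv w hw.2 hw.1
      obtain ⟨k, x, ed, hear⟩ := exists_ear (B := fun v => v = r ∨ v ∈ A)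
        (fun hB => hB.elim hw.1 hw.2) (h.exists_hits hm)
      obtain ⟨A', hlt, hr', hA'⟩ : ∃ A' : Finset V, A ⊂ A' ∧ (r ∉ A → r ∉ A') ∧
          ∃ π₁ π₂ n₁ n₂ f s, Numbering p q r θ τ A' π₁ π₂ n₁ n₂ f s := by
        by_cases hends : x 0 ∈ A → x k ∈ A → f (π₁ (x 0)) < f (π₂ (x k))
        · exact hnum.extend hm hsm hear hends
        · refine hnum.extend hm hsm hear.reverse fun hk h0 => ?_
          simp only [Nat.sub_zero, Nat.sub_self] at hk h0 ⊢
          push Not at hends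
          exact (hnum.lt _ hk).trans_le (hends.2.2.trans (hnum.lt _ h0).le)
      refine ih A' (hr' hr) ?_ hA'
      have := Finset.card_lt_card hlt
      rw [Finset.card_sdiff_of_subset (Finset.subset_univ _)] at hA ⊢
      have := Finset.card_le_univ A'
      simp only [Finset.card_univ] at *
      omega

end EdgeOrder

namespace EdgeOrder

/-! ### Trees given by parent edges -/

/-- Every vertex `v` other than `r` has a parent edge `π v` leading to its parent `n v`, and the
potential `φ` decreases along these edges. -/
structure Parents (G : MG) (r : G.V) (π : G.V → G.E) (n : G.V → G.V) (φ : G.V → ℚ) : Prop where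
  ends : ∀ v, v ≠ r → G.ends (π v) = s(v, n v)
  lt : ∀ v, v ≠ r → n v ≠ r → φ (n v) < φ v

/-- The vertex `a` can be reached from `b` by passing to parents. -/
def Anc {V : Type} (r : V) (n : V → V) : V → V → Prop :=
  Relation.ReflTransGen fun x y => x ≠ r ∧ n x = y

/-- The spanning subgraph formed by the parent edges. -/
def parentSub (G : MG) (r : G.V) (π : G.V → G.E) : MG.Sub G where
  verts := Set.univ
  edges := {e | ∃ v, v ≠ r ∧ π v = e}
  valid _ _ _ _ := trivial

theorem Anc.mono {V α : Type} [Preorder α] {r : V} {n : V → V} {a b : V} (h : Anc r n b a)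
    (ha : a ≠ r) {g : V → α} (hg : ∀ v, v ≠ r → n v ≠ r → g (n v) ≤ g v) :
    b ≠ r ∧ g a ≤ g b := by
  induction h using Relation.ReflTransGen.head_induction_on with
  | refl => exact ⟨ha, le_rfl⟩
  | head hbc _ ih =>
    obtain ⟨hb, rfl⟩ := hbc
    exact ⟨hb, ih.2.trans (hg _ hb ih.1)⟩

namespace Parents

variable {G : MG} {r : G.V} {π : G.V → G.E} {n : G.V → G.V} {φ : G.V → ℚ}

theorem step (h : Parents G r π n φ) {e : G.E} {a b : G.V} (he : e ∈ (parentSub G r π).edges)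
    (hab : G.ends e = s(a, b)) :
    (a ≠ r ∧ e = π a ∧ n a = b) ∨ (b ≠ r ∧ e = π b ∧ n b = a) := by
  obtain ⟨v, hv, rfl⟩ := he
  rw [h.ends v hv, Sym2.eq_iff] at hab
  rcases hab with ⟨rfl, hn⟩ | ⟨rfl, hn⟩
  · exact Or.inl ⟨hv, rfl, hn⟩
  · exact Or.inr ⟨hv, rfl, hn⟩

theorem anc_of_link_down (h : Parents G r π n φ) {z : G.V} : ∀ (es : List G.E) (vs : List G.V)
    (a : G.V), G.IsLink (a :: vs) es → es.Nodup → (∀ e ∈ es, e ∈ (parentSub G r π).edges) →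
    (a :: vs).getLast? = some z → (a ≠ r → es.head? ≠ some (π a)) →
    Anc r n z a ∧ ∀ e ∈ es, ∃ u, u ≠ r ∧ e = π u ∧ Anc r n z u
  | [], [], a, _, _, _, hz, _ => by
    obtain rfl : a = z := by simpa using hz
    exact ⟨Relation.ReflTransGen.refl, by simp⟩
  | [], _ :: _, _, hl, _, _, _, _ => hl.elim
  | _ :: _, [], _, hl, _, _, _, _ => hl.elim
  | e :: es, b :: vs, a, hl, hnd, hT, hz, ha => by
    obtain ⟨hab, hl⟩ := hl
    rw [List.nodup_cons] at hnd
    rcases h.step (hT e (by simp)) hab with ⟨h1, h2, -⟩ | ⟨hb, rfl, hn⟩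
    · exact absurd (by simp [h2]) (ha h1)
    · obtain ⟨h1, h2⟩ := h.anc_of_link_down es vs b hl hnd.2 (fun e he => hT e (by simp [he]))
        (by simpa using hz) fun _ hhead => hnd.1 (List.mem_of_head? hhead)
      refine ⟨h1.tail ⟨hb, hn⟩, fun e he => ?_⟩
      rcases List.mem_cons.1 he with rfl | he
      · exact ⟨b, hb, rfl, h1⟩
      · exact h2 e he

theorem anc_of_link_up (h : Parents G r π n φ) {z : G.V} : ∀ (es : List G.E) (vs : List G.V)
    (a : G.V), G.IsLink (a :: vs) es → es.Nodup → (∀ e ∈ es, e ∈ (parentSub G r π).edges) →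
    (a :: vs).getLast? = some z → π z ∉ es →
    Anc r n a z ∧ ((es = [] ∧ a = z) ∨ es.head? = some (π a))
  | [], [], a, _, _, _, hz, _ => by
    obtain rfl : a = z := by simpa using hz
    exact ⟨Relation.ReflTransGen.refl, by simp⟩
  | [], _ :: _, _, hl, _, _, _, _ => hl.elim
  | _ :: _, [], _, hl, _, _, _, _ => hl.elim
  | e :: es, b :: vs, a, hl, hnd, hT, hz, hes => by
    obtain ⟨hab, hl⟩ := hl
    rw [List.nodup_cons] at hnd
    obtain ⟨h1, h2⟩ := h.anc_of_link_up es vs b hl hnd.2 (fun e he => hT e (by simp [he]))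
      (by simpa using hz) fun he => hes (by simp [he])
    rcases h.step (hT e (by simp)) hab with ⟨ha, rfl, hn⟩ | ⟨hb, rfl, hn⟩
    · exact ⟨h1.head ⟨ha, hn⟩, by simp⟩
    · rcases h2 with ⟨-, rfl⟩ | h2
      · simp at hes
      · exact absurd (List.mem_of_head? h2) hnd.1

theorem isTree [Finite G.V] (h : Parents G r π n φ) : (parentSub G r π).IsTree := by
  refine ⟨⟨⟨r, trivial⟩, ?_⟩, ?_⟩
  · let R : G.V → G.V → Prop :=
      Relation.ReflTransGen fun x y => ∃ e ∈ (parentSub G r π).edges, G.ends e = s(x, y)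
    have hsymm : ∀ {a b}, R a b → R b a := fun {a b} hab => by
      have : Std.Symm fun x y => ∃ e ∈ (parentSub G r π).edges, G.ends e = s(x, y) :=
        ⟨fun x y ⟨e, he, hxy⟩ => ⟨e, he, hxy.trans Sym2.eq_swap⟩⟩
      exact Relation.ReflTransGen.stdSymm.symm _ _ hab
    have hr : ∀ v, R v r := fun v => by
      have hwf : WellFounded fun a b : G.V => φ a < φ b :=
        @Finite.wellFounded_of_trans_of_irrefl G.V _ _ ⟨fun _ _ _ => lt_trans⟩
          ⟨fun _ => lt_irrefl _⟩
      induction v using hwf.induction with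
      | _ v ih =>
        by_cases hv : v = r
        · subst hv
          exact Relation.ReflTransGen.refl
        · have hstep : R v (n v) := Relation.ReflTransGen.single ⟨π v, ⟨v, hv, rfl⟩, h.ends v hv⟩
          by_cases hn : n v = r
          · rwa [hn] at hstep
          · exact hstep.trans (ih _ (h.lt v hv hn))
    exact fun a _ b _ => (hr a).trans (hsymm (hr b))
  · rintro ⟨v, vs, es, ⟨-, hnd, hne, hl⟩, hT⟩
    obtain ⟨e, es, rfl⟩ := List.exists_cons_of_ne_nil hne
    obtain ⟨c, ws, hws⟩ := List.exists_cons_of_ne_nil (show vs ++ [v] ≠ [] by simp)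
    have hlast : (c :: ws).getLast? = some v := by simp [← hws]
    rw [hws] at hl
    obtain ⟨hvc, hl⟩ := hl
    rw [List.nodup_cons] at hnd
    have hT' : ∀ e ∈ es, e ∈ (parentSub G r π).edges := fun e he => hT e (by simp [he])
    have hφ : ∀ v, v ≠ r → n v ≠ r → φ (n v) ≤ φ v := fun v hv hn => (h.lt v hv hn).le
    rcases h.step (hT e (by simp)) hvc with ⟨hv, rfl, rfl⟩ | ⟨hc, rfl, rfl⟩
    · obtain ⟨hn, hle⟩ := (h.anc_of_link_up es ws _ hl hnd.2 hT' hlast hnd.1).1.mono hv hφ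
      exact (h.lt v hv hn).not_ge hle
    · obtain ⟨hn, hle⟩ := (h.anc_of_link_down es ws c hl hnd.2 hT' hlast
        fun _ hhead => hnd.1 (List.mem_of_head? hhead)).1.mono hc hφ
      exact (h.lt c hc hn).not_ge hle

theorem exists_anc_of_pathIn (h : Parents G r π n φ) {v : G.V} {vs : List G.V} {es : List G.E}
    (hp : (parentSub G r π).PathIn r v vs es) {e : G.E} (he : e ∈ es) :
    ∃ u, u ≠ r ∧ e = π u ∧ Anc r n v u := by
  obtain ⟨⟨-, hnd, hl⟩, hhead, hlast, hT⟩ := hp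
  rcases vs with _ | ⟨a, vs⟩
  · simp at hhead
  · obtain rfl : a = r := by simpa using hhead
    exact (h.anc_of_link_down es vs a hl hnd hT hlast fun h => absurd rfl h).2 e he

theorem edgeIndependent {π' : G.V → G.E} {n' : G.V → G.V} {φ' : G.V → ℚ}
    (h : Parents G r π n φ) (h' : Parents G r π' n' φ')
    (hne : ∀ v u u', v ≠ r → u ≠ r → u' ≠ r → Anc r n v u → Anc r n' v u' → π u ≠ π' u') :
    G.EdgeIndependent r (parentSub G r π) (parentSub G r π') := by
  refine ⟨trivial, trivial, fun v _ vs es vs' es' hp hp' e he he' => ?_⟩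
  obtain ⟨u, hu, rfl, hvu⟩ := h.exists_anc_of_pathIn hp he
  obtain ⟨u', hu', heq, hvu'⟩ := h'.exists_anc_of_pathIn hp' he'
  exact hne v u u' (hvu.mono hu (g := φ) fun v hv hn => (h.lt v hv hn).le).1 hu hu' hvu hvu' heq

end Parents

end EdgeOrder

namespace EdgeOrder

section

variable {G : MG} {r : G.V}

theorem edgeIndependent_symm {T T' : MG.Sub G} (h : G.EdgeIndependent r T T') :
    G.EdgeIndependent r T' T :=
  ⟨h.2.1, h.1, fun v hv vs es vs' es' hp hp' e he he' =>
    h.2.2 v hv.symm vs' es' vs es hp' hp e he' he⟩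

theorem Joins.ends_eq {p q : G.E → G.V} (hpq : ∀ e, G.ends e = s(p e, q e)) {e : G.E}
    {a b : G.V} (h : Joins p q e a b) : G.ends e = s(a, b) := by
  rw [hpq]
  rcases h with ⟨rfl, rfl⟩ | ⟨rfl, rfl⟩
  · rfl
  · exact Sym2.eq_swap

variable [Fintype G.V] [DecidableEq G.V] {p q : G.E → G.V} {θ : G.V → ℤ} {τ : G.E → ℤ}
  {π₁ π₂ : G.V → G.E} {n₁ n₂ : G.V → G.V} {f : G.E → ℚ} {s : G.V → ℤ}

theorem mem_erase_root {v : G.V} (hv : v ≠ r) : v ∈ Finset.univ.erase r :=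
  Finset.mem_erase.2 ⟨hv, Finset.mem_univ v⟩

theorem Numbering.parents₁
    (h : Numbering p q r θ τ (Finset.univ.erase r) π₁ π₂ n₁ n₂ f s)
    (hpq : ∀ e, G.ends e = s(p e, q e)) : Parents G r π₁ n₁ fun v => f (π₁ v) where
  ends v hv := (h.joins₁ v (mem_erase_root hv)).ends_eq hpq
  lt v hv hn := h.lt₁ v (mem_erase_root hv) (mem_erase_root hn)

theorem Numbering.parents₂
    (h : Numbering p q r θ τ (Finset.univ.erase r) π₁ π₂ n₁ n₂ f s)
    (hpq : ∀ e, G.ends e = s(p e, q e)) : Parents G r π₂ n₂ fun v => -f (π₂ v) where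
  ends v hv := (h.joins₂ v (mem_erase_root hv)).ends_eq hpq
  lt v hv hn := neg_lt_neg (h.lt₂ v (mem_erase_root hv) (mem_erase_root hn))

theorem Numbering.time_le₁
    (h : Numbering p q r θ τ (Finset.univ.erase r) π₁ π₂ n₁ n₂ f s) {v u : G.V} (hv : v ≠ r)
    (hu : u ≠ r) (hvu : Anc r n₁ v u) : τ (π₁ u) ≤ θ v :=
  (h.time₁ u (mem_erase_root hu)).trans ((hvu.mono hu fun v hv hn =>
    h.mono₁ v (mem_erase_root hv) (mem_erase_root hn)).2.trans (h.le v (mem_erase_root hv)))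

theorem Numbering.time_le₂
    (h : Numbering p q r θ τ (Finset.univ.erase r) π₁ π₂ n₁ n₂ f s) {v u : G.V} (hv : v ≠ r)
    (hu : u ≠ r) (hvu : Anc r n₂ v u) : τ (π₂ u) ≤ θ v :=
  (h.time₂ u (mem_erase_root hu)).trans ((hvu.mono hu fun v hv hn =>
    h.mono₂ v (mem_erase_root hv) (mem_erase_root hn)).2.trans (h.le v (mem_erase_root hv)))

theorem Numbering.edgeIndependent
    (h : Numbering p q r θ τ (Finset.univ.erase r) π₁ π₂ n₁ n₂ f s)
    (hpq : ∀ e, G.ends e = s(p e, q e)) :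
    G.EdgeIndependent r (parentSub G r π₁) (parentSub G r π₂) := by
  refine (h.parents₁ hpq).edgeIndependent (h.parents₂ hpq)
    fun v u u' hv hu hu' hvu hvu' heq => ?_
  have h1 := (hvu.mono hu (g := fun v => f (π₁ v)) fun v hv hn => ((h.parents₁ hpq).lt v hv hn).le).2
  have h2 := (hvu'.mono hu' (g := fun v => -f (π₂ v)) fun v hv hn => ((h.parents₂ hpq).lt v hv hn).le).2
  have h3 := h.lt v (mem_erase_root hv)
  rw [heq] at h1
  linarith

/-- Two independent trees whose paths from `r` to `v` have times at most `θ v`. -/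
theorem EarlyRich.exists_trees [Fintype G.E] [Nonempty G.E] (h : EarlyRich p q r θ τ)
    (hpq : ∀ e, G.ends e = s(p e, q e)) :
    ∃ (π : Fin 2 → G.V → G.E) (n : Fin 2 → G.V → G.V) (φ : Fin 2 → G.V → ℚ),
      (∀ i, Parents G r (π i) (n i) (φ i)) ∧
      G.EdgeIndependent r (parentSub G r (π 0)) (parentSub G r (π 1)) ∧
      ∀ i v u, v ≠ r → u ≠ r → Anc r (n i) v u → τ (π i u) ≤ θ v := by
  obtain ⟨π₁, π₂, n₁, n₂, f, s, hnum⟩ := h.exists_numbering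
  refine ⟨![π₁, π₂], ![n₁, n₂], ![fun v => f (π₁ v), fun v => -f (π₂ v)],
    Fin.forall_fin_two.2 ⟨hnum.parents₁ hpq, hnum.parents₂ hpq⟩, hnum.edgeIndependent hpq,
    Fin.forall_fin_two.2 ⟨fun v u => hnum.time_le₁, fun v u => hnum.time_le₂⟩⟩

end

theorem Ordered.earlyRich {V E : Type} [Fintype V] [DecidableEq V] [Fintype E] {p q : E → V}
    {r : V} {θ : V → ℤ} {τ : E → ℤ}
    (h : Ordered p q Finset.univ (Finset.univ.erase r) θ τ) : EarlyRich p q r θ τ :=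
  fun X hr x hx => (h X (Finset.subset_erase.2 ⟨Finset.subset_univ X, hr⟩) x hx).1

theorem Ordered.earlyRich_neg {V E : Type} [Fintype V] [DecidableEq V] [Fintype E] {p q : E → V}
    {r : V} {θ : V → ℤ} {τ : E → ℤ} (h : Ordered p q Finset.univ (Finset.univ.erase r) θ τ) :
    EarlyRich p q r (fun v => -θ v) (fun e => 1 - τ e) := by
  intro X hr x hx hmin
  have h2 := (h X (Finset.subset_erase.2 ⟨Finset.subset_univ X, hr⟩) x hx).2
    fun y hy => neg_le_neg_iff.1 (hmin y hy)
  refine h2.trans_eq (Finset.sum_congr rfl fun e _ => ?_)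
  simp only [show 1 - τ e ≤ -θ x ↔ θ x < τ e by omega]

theorem fourCut_of_fourEdgeConnected {G : MG} [Fintype G.V] [DecidableEq G.V] [Fintype G.E]
    {p q : G.E → G.V} (hpq : ∀ e, G.ends e = s(p e, q e)) (h4 : G.FourEdgeConnected) (r : G.V) :
    FourCut p q Finset.univ (Finset.univ.erase r) := by
  classical
  rintro X hX ⟨x, hx⟩
  by_contra! hlt
  have hr : r ∉ X := fun h => Finset.notMem_erase r _ (hX h)
  let S : Finset G.E := Finset.univ.filter fun e => ¬ (p e ∈ X ↔ q e ∈ X)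
  have hS : S.card = cut p q Finset.univ X := by
    rw [Finset.card_filter]
    exact Finset.sum_congr rfl fun e _ => ite_not _ _ _
  have hreach := h4.2 S S.finite_toSet (by rwa [Set.ncard_coe_finset, hS]) x r
  suffices ∀ y, G.Reach (S : Set G.E)ᶜ x y → y ∈ X from hr (this r hreach)
  intro y hy
  induction hy with
  | refl => exact hx
  | tail _ hbc ih =>
    obtain ⟨e, he, hbc⟩ := hbc
    have he : p e ∈ X ↔ q e ∈ X := by simpa [S] using he
    rw [hpq, Sym2.eq_iff] at hbc
    rcases hbc with ⟨rfl, rfl⟩ | ⟨rfl, rfl⟩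
    · exact he.1 ih
    · exact he.2 ih

theorem nonempty_edges {G : MG} [Finite G.V] (h4 : G.FourEdgeConnected) : Nonempty G.E := by
  have : Nontrivial G.V := Finite.one_lt_card_iff_nontrivial.1 h4.1
  obtain ⟨a, b, hab⟩ := exists_pair_ne G.V
  rcases (h4.2 ∅ Set.finite_empty (by simp) a b).cases_head with h | ⟨_, ⟨e, -⟩, -⟩
  · exact absurd h hab
  · exact ⟨e⟩

theorem hasFourEIST {G : MG} [Finite G.V] [Finite G.E] (h4 : G.FourEdgeConnected) (r : G.V) :
    G.HasFourEIST r := by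
  classical
  have := Fintype.ofFinite G.V
  have := Fintype.ofFinite G.E
  have := nonempty_edges h4
  let p : G.E → G.V := fun e => (Quot.out (G.ends e)).1
  let q : G.E → G.V := fun e => (Quot.out (G.ends e)).2
  have hpq : ∀ e, G.ends e = s(p e, q e) := fun e => (Quot.out_eq (G.ends e)).symm
  obtain ⟨θ, τ, hord⟩ :=
    exists_ordered _ p q Finset.univ _ le_rfl (fourCut_of_fourEdgeConnected hpq h4 r)
  obtain ⟨π, n, φ, hpar, hind, htime⟩ := hord.earlyRich.exists_trees hpq
  obtain ⟨π', n', φ', hpar', hind', htime'⟩ := hord.earlyRich_neg.exists_trees hpq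
  have hcross : ∀ i j, G.EdgeIndependent r (parentSub G r (π i)) (parentSub G r (π' j)) :=
    fun i j => (hpar i).edgeIndependent (hpar' j) fun v u u' hv hu hu' hvu hvu' heq => by
      have h1 := htime i v u hv hu hvu
      have h2 := htime' j v u' hv hu' hvu'
      rw [heq] at h1
      omega
  let T : Fin 2 ⊕ Fin 2 → MG.Sub G :=
    Sum.elim (fun i => parentSub G r (π i)) fun j => parentSub G r (π' j)
  have hT : ∀ a, (T a).IsTree ∧ (T a).Spanning := by
    rintro (i | j)
    · exact ⟨(hpar i).isTree, rfl⟩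
    · exact ⟨(hpar' j).isTree, rfl⟩
  have hpair : ∀ π : Fin 2 → G.V → G.E,
      G.EdgeIndependent r (parentSub G r (π 0)) (parentSub G r (π 1)) →
      ∀ i j, i ≠ j → G.EdgeIndependent r (parentSub G r (π i)) (parentSub G r (π j)) := by
    intro π h i j hij
    fin_cases i <;> fin_cases j
    · exact absurd rfl hij
    · exact h
    · exact edgeIndependent_symm h
    · exact absurd rfl hij
  let σ : Fin 4 ≃ Fin 2 ⊕ Fin 2 := (finSumFinEquiv (m := 2) (n := 2)).symm
  refine ⟨fun i => T (σ i), fun i => hT _, fun i j hij => ?_⟩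
  have hne : σ i ≠ σ j := σ.injective.ne hij
  show G.EdgeIndependent r (T (σ i)) (T (σ j))
  generalize σ i = a at hne ⊢
  generalize σ j = b at hne ⊢
  rcases a with i | i <;> rcases b with j | j
  · exact hpair π hind i j fun h => hne (h ▸ rfl)
  · exact hcross i j
  · exact edgeIndependent_symm (hcross j i)
  · exact hpair π' hind' i j fun h => hne (h ▸ rfl)

end EdgeOrder

theorem four_edge_independent_spanning_trees (G : MG) [Finite G.V] [Finite G.E]
    (h4 : G.FourEdgeConnected) (r : G.V) : G.HasFourEIST r :=
  EdgeOrder.hasFourEIST h4 r
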